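/- arXiv:1309.1790 — 3 statements merged into one kernel-verified Lean document; each statement's English description precedes it below -/
import Mathlib

section
/- Suppose that the m×m matrix C with entries c_ii = 1 − (A_i(A_i + L_ii)τ_i + L_ii)/α_i and c_ij = −(A_i L_ij τ_i + L_ij)/α_i for i ≠ j is a nonsingular M-matrix. Then the nonlinear delay system ẋ_i(t) = −a_i(t)x_i(h_i(t)) + Σ_{j=1}^m F_{ij}(t, x_j(g_{ij}(t))) is globally exponentially stable. -/
open MeasureTheory

lemma core_aux (x y a h : ℝ → ℝ) (t₀ t₁ T τ α A ν p q K ε : ℝ)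
    (hx : Continuous x)
    (hyi : ∀ t, t₀ ≤ t → IntervalIntegrable y volume t₀ t)
    (hxy : ∀ t, t₀ ≤ t → x t = x t₀ + ∫ s in t₀..t, y s)
    (hα : 0 < α) (hν : 0 < ν) (hp : 0 ≤ p) (hq : q = A * ν + p) (hK : 0 < K) (hε : 0 < ε)
    (hτ : 0 ≤ τ) (hτT : τ ≤ T)
    (ha : ∀ s, t₀ ≤ s → α ≤ a s ∧ a s ≤ A)
    (hh : ∀ s, t₀ ≤ s → 0 ≤ s - h s ∧ s - h s ≤ τ)
    (ht : t₀ < t₁)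
    (hb : ∀ s, t₀ - T ≤ s → s ≤ t₁ → |x s| ≤ K * ν * Real.exp (-ε * (s - t₀)))
    (hbi : ∀ s, t₀ - T ≤ s → s ≤ t₀ → |x s| ≤ ε * K)
    (hy : ∀ s, t₀ ≤ s → s ≤ t₁ →
      |y s + a s * x (h s)| ≤ Real.exp (ε * T) * p * K * Real.exp (-ε * (s - t₀)))
    (hlt : ∀ s, t₀ ≤ s → s < t₁ → x s < K * ν * Real.exp (-ε * (s - t₀)))
    (hεν : ε < ν)
    (hφ : -α * (ν - ε) + A * τ * Real.exp (ε * T) ^ 2 * q + 2 * Real.exp (ε * T) * A * ε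
      + Real.exp (ε * T) * p + ε * ν < 0)
    (heq : x t₁ = K * ν * Real.exp (-ε * (t₁ - t₀))) : False := by
  set E := Real.exp (ε * T) with hE
  set w : ℝ → ℝ := fun s => Real.exp (-ε * (s - t₀)) with hw
  have hwpos : ∀ s, 0 < w s := fun s => Real.exp_pos _
  have hEpos : 0 < E := Real.exp_pos _
  have hT : 0 ≤ T := hτ.trans hτT
  have hA : 0 < A := by have := ha t₀ le_rfl; linarith [this.1, this.2]
  have hqpos : 0 < q := by rw [hq]; positivity
  have hwE : ∀ r s, s - r ≤ T → w r ≤ E * w s := by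
    intro r s hrs
    simp only [hw, hE]
    rw [← Real.exp_add]
    apply Real.exp_le_exp.2
    nlinarith
  have hw0 : w t₀ = 1 := by simp [hw]
  -- bound on y
  have hyb : ∀ r, t₀ ≤ r → r ≤ t₁ → |y r| ≤ E * q * K * w r := by
    intro r h1 h2
    have e1 := hy r h1 h2
    have hhr := hh r h1
    have e2 := hb (h r) (by linarith [hhr.2]) (by linarith [hhr.1])
    have e3 := hwE (h r) r (by linarith [hhr.2])
    have har := ha r h1
    have e4 : |a r * x (h r)| ≤ A * (K * ν * (E * w r)) := by
      rw [abs_mul, abs_of_pos (by linarith : 0 < a r)]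
      apply mul_le_mul har.2 _ (abs_nonneg _) hA.le
      exact e2.trans (mul_le_mul_of_nonneg_left e3 (by positivity))
    have e5 : |y r| ≤ |y r + a r * x (h r)| + |a r * x (h r)| := by
      have := abs_sub (y r + a r * x (h r)) (a r * x (h r))
      simpa using this
    calc |y r| ≤ _ := e5
      _ ≤ E * p * K * w r + A * (K * ν * (E * w r)) := add_le_add e1 e4
      _ = _ := by rw [hq]; ring
  have hint : ∀ r s, t₀ ≤ r → r ≤ s → IntervalIntegrable y volume r s := fun r s h1 h2 =>
    (hyi r h1).symm.trans (hyi s (h1.trans h2))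
  have hdiff : ∀ r s, t₀ ≤ r → r ≤ s → x s - x r = ∫ u in r..s, y u := by
    intro r s h1 h2
    rw [hxy s (h1.trans h2), hxy r h1, ← intervalIntegral.integral_interval_sub_left
      (hyi s (h1.trans h2)) (hyi r h1)]
    ring
  -- bound on the delay difference
  have hd : ∀ s, t₀ ≤ s → s ≤ t₁ →
      |x s - x (h s)| ≤ (τ * E ^ 2 * q + 2 * E * ε) * K * w s := by
    intro s h1 h2
    have hhs := hh s h1
    have key : ∀ r, t₀ ≤ r → r ≤ s → s - r ≤ τ → |x s - x r| ≤ τ * E ^ 2 * q * K * w s := by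
      intro r g1 g2 g3
      rw [hdiff r s g1 g2]
      have : ‖∫ u in r..s, y u‖ ≤ (E * q * K * (E * w s)) * |s - r| := by
        apply intervalIntegral.norm_integral_le_of_norm_le_const
        intro u hu
        rw [Set.uIoc_of_le g2] at hu
        refine (hyb u (by linarith [hu.1]) (hu.2.trans h2)).trans ?_
        exact mul_le_mul_of_nonneg_left (hwE u s (by linarith [hu.1])) (by positivity)
      rw [Real.norm_eq_abs, abs_of_nonneg (by linarith : 0 ≤ s - r)] at this
      refine this.trans ?_
      have hws := hwpos s
      calc E * q * K * (E * w s) * (s - r) ≤ E * q * K * (E * w s) * τ :=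
            mul_le_mul_of_nonneg_left g3 (by positivity)
        _ = _ := by ring
    have hws := hwpos s
    have pos2 : 0 ≤ 2 * E * ε * K * w s := by positivity
    rcases le_total t₀ (h s) with g | g
    · have := key (h s) g (by linarith) hhs.2
      nlinarith
    · have k1 := key t₀ le_rfl h1 (by linarith)
      have k2 := hbi t₀ (by linarith) le_rfl
      have k3 := hbi (h s) (by linarith) g
      have k4 : |x s - x (h s)| ≤ |x s - x t₀| + (|x t₀| + |x (h s)|) := by
        have e1 := abs_sub_le (x s) (x t₀) (x (h s))
        have e2 := abs_sub (x t₀) (x (h s))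
        linarith
      have k5 := hwE t₀ s (by linarith)
      rw [hw0] at k5
      have k6 : ε * K * 1 ≤ ε * K * (E * w s) := mul_le_mul_of_nonneg_left k5 (by positivity)
      nlinarith
  -- near t₁ x is close to the barrier
  have hwc : Continuous w := by simp only [hw]; fun_prop
  have hnear : ∀ᶠ s in nhds t₁, (ν - ε) * K * w s < x s := by
    apply ContinuousAt.eventually_lt (by fun_prop) hx.continuousAt
    rw [heq]
    have := hwpos t₁
    change _ < K * ν * w t₁
    have : 0 < ε * K * w t₁ := by positivity
    nlinarith
  obtain ⟨δ, hδ, hball⟩ := Metric.eventually_nhds_iff.1 hnear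
  set s := max t₀ (t₁ - δ / 2) with hs
  have hs0 : t₀ ≤ s := le_max_left _ _
  have hs1 : s < t₁ := max_lt ht (by linarith)
  have hs2 : t₁ - δ / 2 ≤ s := le_max_right _ _
  -- derivative of the barrier
  have hder : ∀ u, HasDerivAt (fun u => K * ν * w u) (-ε * (K * ν * w u)) u := by
    intro u
    have h1 : HasDerivAt (fun u : ℝ => -ε * (u - t₀)) (-ε * 1) u :=
      ((hasDerivAt_id u).sub_const t₀).const_mul (-ε)
    have h2 := (h1.exp).const_mul (K * ν)
    refine h2.congr_deriv ?_
    change K * ν * (w u * (-ε * 1)) = -ε * (K * ν * w u)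
    ring
  have hVi : ∫ u in s..t₁, -ε * (K * ν * w u) = K * ν * w t₁ - K * ν * w s :=
    intervalIntegral.integral_eq_sub_of_hasDerivAt (fun u _ => hder u)
      (Continuous.intervalIntegrable (by fun_prop) _ _)
  have hle : ∫ u in s..t₁, y u ≤ ∫ u in s..t₁, -ε * (K * ν * w u) := by
    apply intervalIntegral.integral_mono_on hs1.le (hint s t₁ hs0 hs1.le)
      (Continuous.intervalIntegrable (by fun_prop) _ _)
    intro u hu
    have u0 : t₀ ≤ u := hs0.trans hu.1
    have b1 : (ν - ε) * K * w u < x u := by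
      apply hball
      rw [Real.dist_eq, abs_lt]
      constructor <;> linarith [hu.1, hu.2]
    have b2 := (abs_le.1 (hy u u0 hu.2)).2
    have b3 := hd u u0 hu.2
    have hau := ha u u0
    have apos : 0 < a u := by linarith
    have hwu := hwpos u
    have b4 : a u * (x u - x (h u)) ≤ A * ((τ * E ^ 2 * q + 2 * E * ε) * K * w u) := by
      have c1 : a u * (x u - x (h u)) ≤ a u * |x u - x (h u)| :=
        mul_le_mul_of_nonneg_left (le_abs_self _) apos.le
      have c2 : a u * |x u - x (h u)| ≤ A * ((τ * E ^ 2 * q + 2 * E * ε) * K * w u) :=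
        mul_le_mul hau.2 b3 (abs_nonneg _) hA.le
      exact c1.trans c2
    have b5 : α * ((ν - ε) * K * w u) ≤ a u * x u := by
      have : 0 ≤ (ν - ε) * K * w u := by
        have : 0 < ν - ε := by linarith
        positivity
      exact mul_le_mul hau.1 b1.le this apos.le
    have b6 : (-α * (ν - ε) + A * τ * E ^ 2 * q + 2 * E * A * ε + E * p + ε * ν) * (K * w u) ≤ 0 :=
      mul_nonpos_of_nonpos_of_nonneg hφ.le (by positivity)
    change y u + a u * x (h u) ≤ E * p * K * w u at b2
    nlinarith
  have h1 := hdiff s t₁ hs0 hs1.le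
  have h2 := hlt s hs0 hs1
  change x t₁ = K * ν * w t₁ at heq
  change x s < K * ν * w s at h2
  linarith

/-- Theorem 2.1: if the matrix `C` built from the parameters of the nonlinear delay system
`ẋ_i(t) = −a_i(t) x_i(h_i(t)) + Σ_j F_{ij}(t, x_j(g_{ij}(t)))` is a nonsingular M-matrix,
then the system is globally exponentially stable. -/
theorem stmt0
    (m : ℕ) (hm : 0 < m)
    (a : Fin m → ℝ → ℝ) (α A : Fin m → ℝ)
    (F : Fin m → Fin m → ℝ → ℝ → ℝ) (L : Fin m → Fin m → ℝ)
    (h : Fin m → ℝ → ℝ) (g : Fin m → Fin m → ℝ → ℝ)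
    (τ : Fin m → ℝ) (σ : ℝ)
    -- (a1)
    (ha_meas : ∀ i, Measurable (a i))
    (hα : ∀ i, 0 < α i)
    (ha_bd : ∀ i t, 0 ≤ t → α i ≤ a i t ∧ a i t ≤ A i)
    -- (a2)
    (hF_cont : ∀ i j t, Continuous (F i j t))
    (hF_meas : ∀ i j u, Measurable fun t => F i j t u)
    (hF_bd : ∀ i j t u, 0 ≤ t → |F i j t u| ≤ L i j * |u|)
    -- (a3)
    (hh_meas : ∀ i, Measurable (h i))
    (hh : ∀ i t, 0 ≤ t → 0 ≤ t - h i t ∧ t - h i t ≤ τ i)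
    (hg_meas : ∀ i j, Measurable (g i j))
    (hg : ∀ i j t, 0 ≤ t → 0 ≤ t - g i j t ∧ t - g i j t ≤ σ)
    -- the matrix C of (3)
    (C : Matrix (Fin m) (Fin m) ℝ)
    (hC_def : ∀ i j, C i j =
      if i = j then 1 - (A i * (A i + L i i) * τ i + L i i) / α i
      else -(A i * L i j * τ i + L i j) / α i)
    -- C is a nonsingular M-matrix
    (hC_offdiag : ∀ i j, i ≠ j → C i j ≤ 0)
    (hC_unit : IsUnit C.det)
    (hC_invpos : ∀ i j, 0 < C⁻¹ i j) :
    -- global exponential stability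
    ∃ M Λ : ℝ, 0 < M ∧ 0 < Λ ∧
      ∀ t₀ : ℝ, 0 ≤ t₀ → ∀ x : Fin m → ℝ → ℝ,
        (∀ i, Continuous (x i)) →
        (∀ i t, t₀ ≤ t → IntervalIntegrable
            (fun s => -(a i s) * x i (h i s) + ∑ j, F i j s (x j (g i j s)))
            volume t₀ t) →
        (∀ i t, t₀ ≤ t →
          x i t = x i t₀ + ∫ s in t₀..t,
            (-(a i s) * x i (h i s) + ∑ j, F i j s (x j (g i j s)))) →
        ∀ t, t₀ ≤ t →
          ‖(fun i => x i t : Fin m → ℝ)‖ ≤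
            M * Real.exp (-Λ * (t - t₀)) *
              (‖(fun i => x i t₀ : Fin m → ℝ)‖ +
                sSup ((fun s => ‖(fun i => x i s : Fin m → ℝ)‖) ''
                  Set.Icc (t₀ - max σ (⨆ i, τ i)) t₀)) := by
  classical
  have hA : ∀ i, 0 < A i := fun i => by
    have := ha_bd i 0 le_rfl
    linarith [hα i, this.1, this.2]
  have hL : ∀ i j, 0 ≤ L i j := fun i j => by
    have := hF_bd i j 0 1 le_rfl
    have h2 := abs_nonneg (F i j 0 1)
    simp at this
    linarith
  have hτ : ∀ i, 0 ≤ τ i := fun i => by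
    have := hh i 0 le_rfl
    linarith [this.1, this.2]
  have hne : Nonempty (Fin m) := ⟨⟨0, hm⟩⟩
  set T := max σ (⨆ i, τ i) with hTdef
  have hτT : ∀ i, τ i ≤ T := fun i =>
    (le_ciSup (Set.finite_range τ).bddAbove i).trans (le_max_right _ _)
  have hσT : σ ≤ T := le_max_left _ _
  have hT : 0 ≤ T := (hτ ⟨0, hm⟩).trans (hτT _)
  -- the positive vector
  obtain ⟨ν, hν, hCν⟩ : ∃ ν : Fin m → ℝ, (∀ i, 0 < ν i) ∧ ∀ i, ∑ j, C i j * ν j = 1 := by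
    refine ⟨fun i => ∑ j, C⁻¹ i j, fun i => Finset.sum_pos (fun j _ => hC_invpos i j)
      Finset.univ_nonempty, fun i => ?_⟩
    have h1 : C.mulVec (C⁻¹.mulVec (fun _ => 1)) = fun _ => 1 := by
      rw [Matrix.mulVec_mulVec, Matrix.mul_nonsing_inv C hC_unit, Matrix.one_mulVec]
    have h2 := congrFun h1 i
    simpa [Matrix.mulVec, dotProduct] using h2
  set p : Fin m → ℝ := fun i => ∑ j, L i j * ν j with hpdef
  have hp : ∀ i, 0 ≤ p i := fun i =>
    Finset.sum_nonneg fun j _ => mul_nonneg (hL i j) (hν j).le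
  have hkey : ∀ i, A i * τ i * (A i * ν i + p i) + p i < α i * ν i := by
    intro i
    have hCij : ∀ j, C i j * ν j = (if i = j then (1 - A i * A i * τ i / α i) * ν j else 0)
        - (A i * τ i + 1) / α i * (L i j * ν j) := by
      intro j
      rw [hC_def]
      have := (hα i).ne'
      split_ifs with hij
      · subst hij; field_simp; ring
      · field_simp; ring
    have h1 := hCν i
    simp_rw [hCij] at h1
    rw [Finset.sum_sub_distrib, ← Finset.mul_sum, Finset.sum_ite_eq] at h1
    simp only [Finset.mem_univ, if_true] at h1
    change _ - _ * p i = 1 at h1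
    have := hα i
    field_simp at h1
    nlinarith
  -- choice of ε
  obtain ⟨ε, hε, hεall⟩ : ∃ ε : ℝ, 0 < ε ∧ ∀ i, ε < ν i ∧
      -α i * (ν i - ε) + A i * τ i * Real.exp (ε * T) ^ 2 * (A i * ν i + p i)
      + 2 * Real.exp (ε * T) * A i * ε + Real.exp (ε * T) * p i + ε * ν i < 0 := by
    have : ∀ᶠ ε in nhds (0:ℝ), ∀ i, ε < ν i ∧
      -α i * (ν i - ε) + A i * τ i * Real.exp (ε * T) ^ 2 * (A i * ν i + p i)
      + 2 * Real.exp (ε * T) * A i * ε + Real.exp (ε * T) * p i + ε * ν i < 0 := by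
      rw [Filter.eventually_all]
      intro i
      refine (eventually_lt_nhds (hν i)).and ?_
      apply ContinuousAt.eventually_lt (by fun_prop) continuousAt_const
      have := hkey i
      simp
      linarith
    obtain ⟨δ, hδ, hb⟩ := Metric.eventually_nhds_iff.1 this
    exact ⟨δ / 2, by linarith, hb (by rw [Real.dist_eq, sub_zero, abs_of_pos] <;> linarith)⟩
  refine ⟨(∑ i, ν i) / ε, ε, div_pos (Finset.sum_pos (fun i _ => hν i) Finset.univ_nonempty) hε,
    hε, ?_⟩
  intro t₀ ht₀ x hx hyi hxy t ht
  set N := sSup ((fun s => ‖(fun i => x i s : Fin m → ℝ)‖) '' Set.Icc (t₀ - T) t₀) with hN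
  have hNb : ∀ i s, t₀ - T ≤ s → s ≤ t₀ → |x i s| ≤ N := by
    intro i s h1 h2
    have hc : Continuous (fun s => ‖(fun i => x i s : Fin m → ℝ)‖) :=
      (continuous_pi fun i => hx i).norm
    have h3 := le_csSup (isCompact_Icc.image hc).bddAbove
      (Set.mem_image_of_mem (fun s => ‖(fun i => x i s : Fin m → ℝ)‖) (Set.mem_Icc.2 ⟨h1, h2⟩))
    exact (norm_le_pi_norm (fun i => x i s : Fin m → ℝ) i).trans h3
  have hN0 : 0 ≤ N := (abs_nonneg _).trans (hNb ⟨0, hm⟩ t₀ (by linarith) le_rfl)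
  -- main comparison
  have main : ∀ K, 0 < K → N ≤ ε * K → ∀ t, t₀ ≤ t → ∀ i,
      |x i t| < K * ν i * Real.exp (-ε * (t - t₀)) := by
    intro K hK hNK
    by_contra! hcon
    obtain ⟨t', ht', hi'⟩ := hcon
    set S : Set ℝ := {s | t₀ ≤ s ∧ ∃ i, K * ν i * Real.exp (-ε * (s - t₀)) ≤ |x i s|} with hS
    have hSc : IsClosed S := by
      have : S = Set.Ici t₀ ∩ ⋃ i, {s | K * ν i * Real.exp (-ε * (s - t₀)) ≤ |x i s|} := by
        ext s; simp [hS]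
      rw [this]
      refine isClosed_Ici.inter (isClosed_iUnion_of_finite fun i => ?_)
      exact isClosed_le (by fun_prop) (hx i).abs
    have hSbdd : BddBelow S := ⟨t₀, fun s hs => hs.1⟩
    have hmem : sInf S ∈ S := hSc.csInf_mem ⟨t', ht', hi'⟩ hSbdd
    set t₁ := sInf S with ht₁
    have hlt : ∀ j s, t₀ ≤ s → s < t₁ → |x j s| < K * ν j * Real.exp (-ε * (s - t₀)) := by
      intro j s h1 h2
      by_contra! h3
      exact absurd (csInf_le hSbdd (show s ∈ S from ⟨h1, j, h3⟩)) (not_le.2 h2)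
    have hinit : ∀ j s, t₀ - T ≤ s → s ≤ t₀ → |x j s| < K * ν j * Real.exp (-ε * (s - t₀)) := by
      intro j s h1 h2
      have e1 : 1 ≤ Real.exp (-ε * (s - t₀)) := Real.one_le_exp (by nlinarith)
      have e2 : ε * K < K * ν j := by nlinarith [(hεall j).1]
      have e3 : 0 < K * ν j := mul_pos hK (hν j)
      nlinarith [hNb j s h1 h2]
    obtain ⟨h01, i, hi⟩ := hmem
    have h01' : t₀ < t₁ := by
      rcases h01.lt_or_eq with h | h
      · exact h
      · exact absurd hi (not_le.2 (hinit i t₁ (by linarith) h.ge))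
    have hb : ∀ j s, t₀ - T ≤ s → s ≤ t₁ → |x j s| ≤ K * ν j * Real.exp (-ε * (s - t₀)) := by
      intro j s h1 h2
      rcases le_total s t₀ with h3 | h3
      · exact (hinit j s h1 h3).le
      · have hcl : IsClosed {s | |x j s| ≤ K * ν j * Real.exp (-ε * (s - t₀))} :=
          isClosed_le (hx j).abs (by fun_prop)
        have hsub : Set.Ico t₀ t₁ ⊆ {s | |x j s| ≤ K * ν j * Real.exp (-ε * (s - t₀))} :=
          fun s hs => (hlt j s hs.1 hs.2).le
        have := closure_minimal hsub hcl
        rw [closure_Ico h01'.ne] at this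
        exact this ⟨h3, h2⟩
    have hFb : ∀ s, t₀ ≤ s → s ≤ t₁ → |∑ j, F i j s (x j (g i j s))| ≤
        Real.exp (ε * T) * p i * K * Real.exp (-ε * (s - t₀)) := by
      intro s h1 h2
      have s0 : 0 ≤ s := ht₀.trans h1
      have e1 : ∀ j, |F i j s (x j (g i j s))| ≤
          L i j * (K * ν j * (Real.exp (ε * T) * Real.exp (-ε * (s - t₀)))) := by
        intro j
        have hgs := hg i j s s0
        refine (hF_bd i j s _ s0).trans (mul_le_mul_of_nonneg_left ?_ (hL i j))
        refine (hb j _ (by linarith [hgs.2]) (by linarith [hgs.1])).trans ?_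
        refine mul_le_mul_of_nonneg_left ?_ (mul_pos hK (hν j)).le
        rw [← Real.exp_add]
        apply Real.exp_le_exp.2
        nlinarith [hgs.2]
      refine (Finset.abs_sum_le_sum_abs _ _).trans ((Finset.sum_le_sum fun j _ => e1 j).trans ?_)
      apply le_of_eq
      simp only [hpdef, Finset.mul_sum, Finset.sum_mul]
      exact Finset.sum_congr rfl fun j _ => by ring
    have heq : |x i t₁| = K * ν i * Real.exp (-ε * (t₁ - t₀)) :=
      le_antisymm (hb i t₁ (by linarith) le_rfl) hi
    rcases abs_choice (x i t₁) with hc | hc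
    · refine core_aux (x i) (fun s => -(a i s) * x i (h i s) + ∑ j, F i j s (x j (g i j s)))
        (a i) (h i) t₀ t₁ T (τ i) (α i) (A i) (ν i) (p i) _ K ε (hx i) (hyi i) (hxy i)
        (hα i) (hν i) (hp i) rfl hK hε (hτ i) (hτT i) (fun s hs => ha_bd i s (ht₀.trans hs))
        (fun s hs => hh i s (ht₀.trans hs)) h01' (hb i)
        (fun s h1 h2 => (hNb i s h1 h2).trans hNK) (fun s h1 h2 => ?_)
        (fun s h1 h2 => (le_abs_self _).trans_lt (hlt i s h1 h2)) (hεall i).1 (hεall i).2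
        (hc ▸ heq)
      convert hFb s h1 h2 using 2
      ring
    · refine core_aux (fun s => -x i s)
        (fun s => -(-(a i s) * x i (h i s) + ∑ j, F i j s (x j (g i j s))))
        (a i) (h i) t₀ t₁ T (τ i) (α i) (A i) (ν i) (p i) _ K ε (hx i).neg
        (fun t ht => (hyi i t ht).neg) (fun t ht => ?_)
        (hα i) (hν i) (hp i) rfl hK hε (hτ i) (hτT i) (fun s hs => ha_bd i s (ht₀.trans hs))
        (fun s hs => hh i s (ht₀.trans hs)) h01' (fun s h1 h2 => by rw [abs_neg]; exact hb i s h1 h2)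
        (fun s h1 h2 => by rw [abs_neg]; exact (hNb i s h1 h2).trans hNK) (fun s h1 h2 => ?_)
        (fun s h1 h2 => (neg_le_abs _).trans_lt (hlt i s h1 h2)) (hεall i).1 (hεall i).2
        (hc ▸ heq)
      · rw [intervalIntegral.integral_neg, hxy i t ht]; ring
      · rw [← abs_neg]
        convert hFb s h1 h2 using 2
        ring
  have hlim : ∀ i, |x i t| ≤ N / ε * ν i * Real.exp (-ε * (t - t₀)) := by
    intro i
    have hc : Filter.Tendsto (fun e : ℝ => (N / ε + e) * ν i * Real.exp (-ε * (t - t₀)))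
        (nhdsWithin 0 (Set.Ioi 0)) (nhds ((N / ε + 0) * ν i * Real.exp (-ε * (t - t₀)))) :=
      (Continuous.tendsto (by fun_prop) 0).mono_left nhdsWithin_le_nhds
    rw [add_zero] at hc
    refine ge_of_tendsto hc ?_
    filter_upwards [self_mem_nhdsWithin] with e he
    have he : 0 < e := he
    refine (main (N / ε + e) (by positivity) ?_ t ht i).le
    have : ε * (N / ε + e) = N + ε * e := by field_simp
    rw [this]
    have := mul_pos hε he
    linarith
  have hνs : ∀ i, ν i ≤ ∑ j, ν j := fun i =>
    Finset.single_le_sum (fun j _ => (hν j).le) (Finset.mem_univ i)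
  have hsum : 0 ≤ ∑ j, ν j := Finset.sum_nonneg fun j _ => (hν j).le
  rw [pi_norm_le_iff_of_nonneg (by positivity)]
  intro i
  rw [Real.norm_eq_abs]
  refine (hlim i).trans ?_
  calc N / ε * ν i * Real.exp (-ε * (t - t₀))
      ≤ N / ε * (∑ j, ν j) * Real.exp (-ε * (t - t₀)) := by
        have := hνs i
        gcongr
    _ = (∑ j, ν j) / ε * Real.exp (-ε * (t - t₀)) * (0 + N) := by ring
    _ ≤ _ := by
        gcongr
        exact norm_nonneg _
end

section
/- Suppose the 2n×2n matrix C_BAM with entries c_ii = 1 − a_i R_i² τ_i^(1)/α_i for i = 1,…,n, c_ii = 1 − b_{i−n} P_{i−n}² τ_{i−n}^(2)/β_{i−n} for i = n+1,…,2n, c_ij = −|a_{i,j−n}| R_i L_{j−n}^f (a_i R_i τ_i^(1) + 1)/(α_i a_i) for i = 1,…,n and j = n+1,…,2n, c_ij = −|b_{i−n,j}| P_{i−n} L_j^g (b_{i−n} P_{i−n} τ_{i−n}^(2) + 1)/(β_{i−n} b_{i−n}) for i = n+1,…,2n and j = 1,…,n, and c_ij = 0 otherwise, is a nonsingular M-matrix.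 Then the equilibrium (x*, y*) of the BAM system is globally exponentially stable. -/
open MeasureTheory

/-- Scalar comparison with a decaying exponential. -/
lemma aux_compare (z F : ℝ → ℝ) (t₀ N lam : ℝ) (hz : Continuous z)
    (hF : ∀ t, t₀ ≤ t → IntervalIntegrable F volume t₀ t)
    (hzF : ∀ t, t₀ ≤ t → z t = z t₀ + ∫ s in t₀..t, F s)
    (T : ℝ) (h0 : z t₀ ≤ N)
    (hdec : ∀ s, t₀ ≤ s → s ≤ T → N * Real.exp (-lam * (s - t₀)) ≤ z s →
      F s ≤ -lam * N * Real.exp (-lam * (s - t₀))) :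
    ∀ t, t₀ ≤ t → t ≤ T → z t ≤ N * Real.exp (-lam * (t - t₀)) := by
  intro t ht htT
  by_contra hcon
  push Not at hcon
  set m : ℝ → ℝ := fun s => N * Real.exp (-lam * (s - t₀)) with hm
  have hmc : Continuous m := by rw [hm]; fun_prop
  -- last time at which `z ≤ m`
  set S : Set ℝ := {s | z s ≤ m s} ∩ Set.Icc t₀ t with hS
  have hSc : IsCompact S :=
    isCompact_Icc.inter_left (isClosed_le hz hmc)
  have hSne : S.Nonempty := ⟨t₀, by simp [hm, h0], le_refl _, ht⟩
  obtain ⟨s, hsS, hsmax⟩ := hSc.exists_isMaxOn hSne continuous_id.continuousOn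
  have hs1 : z s ≤ m s := hsS.1
  have hs2 : t₀ ≤ s := hsS.2.1
  have hs3 : s ≤ t := hsS.2.2
  have hgt : ∀ v, s < v → v ≤ t → m v < z v := by
    intro v hv hvt
    by_contra hc
    push Not at hc
    have : v ∈ S := ⟨hc, hs2.trans hv.le, hvt⟩
    have := hsmax this
    simp at this
    linarith
  have hFst : IntervalIntegrable F volume s t := (hF s hs2).symm.trans (hF t ht)
  have hdiff : z t - z s = ∫ v in s..t, F v := by
    rw [hzF t ht, hzF s hs2, ← intervalIntegral.integral_add_adjacent_intervals (hF s hs2) hFst]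
    ring
  have hmder : ∀ v, HasDerivAt m (-lam * N * Real.exp (-lam * (v - t₀))) v := by
    intro v
    have h1 : HasDerivAt (fun s : ℝ => -lam * (s - t₀)) (-lam) v := by
      simpa using ((hasDerivAt_id v).sub_const t₀).const_mul (-lam)
    have h2 := (h1.exp).const_mul N
    exact h2.congr_deriv (by ring)
  have hmint : ∫ v in s..t, (-lam * N * Real.exp (-lam * (v - t₀))) = m t - m s := by
    apply intervalIntegral.integral_eq_sub_of_hasDerivAt
    · intro v _; exact hmder v
    · apply Continuous.intervalIntegrable; fun_prop
  have hle : ∫ v in s..t, F v ≤ ∫ v in s..t, (-lam * N * Real.exp (-lam * (v - t₀))) := by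
    apply intervalIntegral.integral_mono_on_of_le_Ioo hs3 hFst
    · apply Continuous.intervalIntegrable; fun_prop
    · intro v hv
      exact hdec v (hs2.trans hv.1.le) (hv.2.le.trans htT) (hgt v hv.1 hv.2.le).le
  have : m t < z t := hcon
  linarith

/-- Choice of the decay rate, contraction constant and additive constant. -/
lemma aux_choice {ι : Type*} [Fintype ι] [Nonempty ι] (A α R τ d W : ι → ℝ) (H : ℝ)
    (hA : ∀ k, 0 < A k) (hα : ∀ k, 0 < α k) (hd : ∀ k, 0 < d k)
    (hsmall : ∀ k, τ k * R k * (A k * d k + W k) + W k / A k < d k) :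
    ∃ lam θ c : ℝ, 0 < lam ∧ θ < 1 ∧ 0 ≤ θ ∧ 0 < c ∧ ∀ k, lam < α k * A k ∧
      α k / (α k * A k - lam) * (A k * (τ k * R k * (A k * d k + W k) * Real.exp (2 * (lam * H)))
        + W k * Real.exp (lam * H)) ≤ θ * d k ∧
      α k / (α k * A k - lam) * (A k * (2 * Real.exp (lam * H))) + 1 ≤ c * d k := by
  have key : ∀ k, ∀ᶠ lam in nhds (0:ℝ), lam < α k * A k ∧
      α k / (α k * A k - lam) * (A k * (τ k * R k * (A k * d k + W k) * Real.exp (2 * (lam * H)))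
        + W k * Real.exp (lam * H)) / d k < 1 := by
    intro k
    have hpos : 0 < α k * A k := mul_pos (hα k) (hA k)
    apply (eventually_lt_nhds hpos).and
    have hc : ContinuousAt (fun lam : ℝ => α k / (α k * A k - lam) * (A k * (τ k * R k * (A k * d k + W k) * Real.exp (2 * (lam * H)))
        + W k * Real.exp (lam * H)) / d k) 0 := by
      apply ContinuousAt.div_const
      apply ContinuousAt.mul
      · apply ContinuousAt.div
        · fun_prop
        · fun_prop
        · simpa using hpos.ne'
      · fun_prop
    apply hc.eventually_lt continuousAt_const
    rw [div_lt_one (hd k)]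
    simp only [zero_mul, mul_zero, Real.exp_zero, sub_zero, mul_one]
    have h1 := (hα k).ne'
    have h2 := (hA k).ne'
    have : α k / (α k * A k) * (A k * (τ k * R k * (A k * d k + W k)) + W k)
      = τ k * R k * (A k * d k + W k) + W k / A k := by
      field_simp
    rw [this]; exact hsmall k
  have key2 := (Filter.eventually_all.2 key)
  have key3 : ∀ᶠ lam in nhdsWithin (0:ℝ) (Set.Ioi 0), _ := key2.filter_mono nhdsWithin_le_nhds
  obtain ⟨lam, hlam, hlampos⟩ := (key3.and self_mem_nhdsWithin).exists
  obtain ⟨k1, hk1⟩ := Finite.exists_max (fun k => α k / (α k * A k - lam) * (A k * (τ k * R k * (A k * d k + W k) * Real.exp (2 * (lam * H)))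
        + W k * Real.exp (lam * H)) / d k)
  obtain ⟨k2, hk2⟩ := Finite.exists_max (fun k => (α k / (α k * A k - lam) * (A k * (2 * Real.exp (lam * H))) + 1) / d k)
  refine ⟨lam, max 0 (α k1 / (α k1 * A k1 - lam) * (A k1 * (τ k1 * R k1 * (A k1 * d k1 + W k1) * Real.exp (2 * (lam * H)))
        + W k1 * Real.exp (lam * H)) / d k1), (α k2 / (α k2 * A k2 - lam) * (A k2 * (2 * Real.exp (lam * H))) + 1) / d k2, hlampos, ?_, le_max_left _ _, ?_, ?_⟩
  · exact max_lt one_pos (hlam k1).2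
  · have h1 := hα k2
    have h2 := hA k2
    have h3 := hd k2
    have h4 : 0 < α k2 * A k2 - lam := sub_pos.2 (hlam k2).1
    positivity
  · intro k
    refine ⟨(hlam k).1, ?_, ?_⟩
    · rw [← div_le_iff₀ (hd k)]
      exact (hk1 k).trans (le_max_right _ _)
    · rw [← div_le_iff₀ (hd k)]
      exact hk2 k

/-- One improvement step of the a priori bound. -/
lemma aux_step {ι : Type*} [Fintype ι] (A α R τ d W : ι → ℝ) (w : ι → ι → ℝ) (H : ℝ)
    (hH : 0 ≤ H)
    (hA : ∀ k, 0 < A k) (hα : ∀ k, 0 < α k) (hd : ∀ k, 0 < d k)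
    (hw : ∀ k j, 0 ≤ w k j) (hW : ∀ k, W k = ∑ j, w k j * d j)
    (hτH : ∀ k, τ k ≤ H)
    (lam θ c : ℝ) (hlam : 0 < lam)
    (hch : ∀ k, lam < α k * A k ∧
      α k / (α k * A k - lam) * (A k * (τ k * R k * (A k * d k + W k) * Real.exp (2 * (lam * H)))
        + W k * Real.exp (lam * H)) ≤ θ * d k ∧
      α k / (α k * A k - lam) * (A k * (2 * Real.exp (lam * H))) + 1 ≤ c * d k)
    (t₀ : ℝ) (z F : ι → ℝ → ℝ) (hz : ∀ k, Continuous (z k))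
    (hF : ∀ k t, t₀ ≤ t → IntervalIntegrable (F k) volume t₀ t)
    (hzF : ∀ k t, t₀ ≤ t → z k t = z k t₀ + ∫ s in t₀..t, F k s)
    (hstr : ∀ k s, t₀ ≤ s → ∃ (ρ h e : ℝ) (l : ι → ℝ), α k ≤ ρ ∧ ρ ≤ R k ∧ 0 ≤ s - h ∧
      s - h ≤ τ k ∧ (∀ j, 0 ≤ s - l j ∧ s - l j ≤ H) ∧ |e| ≤ ∑ j, w k j * |z j (l j)| ∧
      F k s = ρ * (-(A k) * z k h + e))
    (Φ : ℝ) (hΦ : ∀ k s, t₀ - H ≤ s → s ≤ t₀ → |z k s| ≤ Φ)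
    (T B : ℝ) (hB : 0 ≤ B) (hΦ0 : 0 ≤ Φ)
    (hbd : ∀ k s, t₀ - H ≤ s → s ≤ T → |z k s| ≤ d k * B * Real.exp (-lam * (s - t₀))) :
    ∀ k s, t₀ - H ≤ s → s ≤ T →
      |z k s| ≤ d k * (θ * B + c * Φ) * Real.exp (-lam * (s - t₀)) := by
  intro k
  set X := Real.exp (lam * H) with hX
  have hXpos : 0 < X := Real.exp_pos _
  have hX2 : Real.exp (2 * (lam * H)) = X * X := by
    rw [hX, ← Real.exp_add]; congr 1; ring
  obtain ⟨hk1, hk2, hk3⟩ := hch k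
  rw [hX2] at hk2
  have hshift : ∀ s v, s - v ≤ H → Real.exp (-lam * (v - t₀)) ≤ X * Real.exp (-lam * (s - t₀)) := by
    intro s v hv
    rw [hX, ← Real.exp_add]
    apply Real.exp_le_exp.2
    nlinarith
  have hW0 : 0 ≤ W k := by
    rw [hW]; exact Finset.sum_nonneg fun j _ => mul_nonneg (hw k j) (hd j).le
  -- bound for u
  have hu : ∀ s, s ≤ T → t₀ ≤ s → ∀ l : ι → ℝ, (∀ j, 0 ≤ s - l j ∧ s - l j ≤ H) →
      ∑ j, w k j * |z j (l j)| ≤ W k * B * X * Real.exp (-lam * (s - t₀)) := by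
    intro s hsT hs l hl
    rw [hW, Finset.sum_mul, Finset.sum_mul, Finset.sum_mul]
    apply Finset.sum_le_sum
    intro j _
    have h1 := hbd j (l j) (by linarith [(hl j).2]) (by linarith [(hl j).1])
    have h2 := hshift s (l j) (hl j).2
    have h3 : 0 ≤ d j * B := mul_nonneg (hd j).le hB
    calc w k j * |z j (l j)| ≤ w k j * (d j * B * (X * Real.exp (-lam * (s - t₀)))) :=
          mul_le_mul_of_nonneg_left (h1.trans (mul_le_mul_of_nonneg_left h2 h3)) (hw k j)
      _ = _ := by ring
  have hR0 : t₀ ≤ T → 0 ≤ R k := by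
    intro h
    obtain ⟨ρ, _, _, _, h1, h2, _⟩ := hstr k t₀ le_rfl
    linarith [hα k]
  -- bound for F
  have hFb : ∀ s, s ≤ T → t₀ ≤ s →
      |F k s| ≤ R k * (A k * d k + W k) * B * X * Real.exp (-lam * (s - t₀)) := by
    intro s hsT hs
    obtain ⟨ρ, h, e, l, h1, h2, h3, h4, h5, h6, h7⟩ := hstr k s hs
    rw [h7, abs_mul, abs_of_pos (lt_of_lt_of_le (hα k) h1)]
    have h8 := h6.trans (hu s hsT hs l h5)
    have h9 := hbd k h (by linarith [hτH k]) (by linarith)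
    have h10 := h9.trans (mul_le_mul_of_nonneg_left (hshift s h (h4.trans (hτH k)))
      (mul_nonneg (hd k).le hB))
    have h11 : |-(A k) * z k h + e| ≤ A k * |z k h| + |e| := by
      refine (abs_add_le _ _).trans ?_
      rw [abs_mul, abs_neg, abs_of_pos (hA k)]
    have h12 := mul_le_mul_of_nonneg_left h10 (hA k).le
    calc ρ * |-(A k) * z k h + e| ≤ R k * (A k * (d k * B * (X * Real.exp (-lam * (s - t₀)))) + W k * B * X * Real.exp (-lam * (s - t₀))) := by
          apply mul_le_mul h2 (by linarith) (abs_nonneg _) (hR0 (hs.trans hsT))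
      _ = _ := by ring
  -- increments
  set Q := R k * (A k * d k + W k) * B * X with hQ
  have hQ0 : t₀ ≤ T → 0 ≤ Q := by
    intro h
    have := hR0 h
    have := hA k
    have := hd k
    positivity
  have hinc : ∀ v s, t₀ ≤ v → v ≤ s → s ≤ T → s - v ≤ τ k →
      |z k s - z k v| ≤ τ k * (Q * (X * Real.exp (-lam * (s - t₀)))) := by
    intro v s hv hvs hsT hsv
    have hI : IntervalIntegrable (F k) volume v s := (hF k v hv).symm.trans (hF k s (hv.trans hvs))
    have hdiff : z k s - z k v = ∫ q in v..s, F k q := by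
      rw [hzF k s (hv.trans hvs), hzF k v hv,
        ← intervalIntegral.integral_add_adjacent_intervals (hF k v hv) hI]
      ring
    rw [hdiff]
    have hQ1 := hQ0 (by linarith)
    have hb : ‖∫ q in v..s, F k q‖ ≤ (Q * (X * Real.exp (-lam * (s - t₀)))) * |s - v| := by
      apply intervalIntegral.norm_integral_le_of_norm_le_const
      intro q hq
      rw [Set.uIoc_of_le hvs] at hq
      rw [Real.norm_eq_abs]
      refine (hFb q (hq.2.trans hsT) (hv.trans hq.1.le)).trans ?_
      apply mul_le_mul_of_nonneg_left _ hQ1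
      apply hshift
      linarith [hq.1, hτH k]
    rw [Real.norm_eq_abs, abs_of_nonneg (sub_nonneg.2 hvs)] at hb
    refine hb.trans ?_
    rw [mul_comm]
    apply mul_le_mul_of_nonneg_right hsv
    positivity
  have hdel : ∀ h s, t₀ ≤ s → s ≤ T → 0 ≤ s - h → s - h ≤ τ k →
      |z k s - z k h| ≤ (τ k * (Q * X) + 2 * Φ * X) * Real.exp (-lam * (s - t₀)) := by
    intro h s hs hsT hh1 hh2
    by_cases hh : t₀ ≤ h
    · have := hinc h s hh (by linarith) hsT hh2
      have h2 : 0 ≤ 2 * Φ * X * Real.exp (-lam * (s - t₀)) := by positivity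
      linarith
    · push Not at hh
      have h1 := hinc t₀ s le_rfl hs hsT (by linarith)
      have h2 := hΦ k h (by linarith [hτH k]) hh.le
      have h3 := hΦ k t₀ (by linarith) le_rfl
      have h4 : (1:ℝ) ≤ X * Real.exp (-lam * (s - t₀)) := by
        have := hshift s t₀ (by linarith [hτH k])
        simpa using this
      have h5 := mul_le_mul_of_nonneg_left h4 hΦ0
      have h6 : |z k s - z k h| ≤ |z k s - z k t₀| + (|z k t₀| + |z k h|) := by
        have e1 := abs_add_le (z k s - z k t₀) (z k t₀ - z k h)
        have e2 := abs_sub (z k t₀) (z k h)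
        have e3 : z k s - z k t₀ + (z k t₀ - z k h) = z k s - z k h := by ring
        rw [e3] at e1
        linarith
      linarith
  set E := A k * (τ k * (Q * X) + 2 * Φ * X) + W k * B * X with hE
  set N := α k / (α k * A k - lam) * E + Φ with hN
  have hden : 0 < α k * A k - lam := sub_pos.2 hk1
  have hNle : N ≤ d k * (θ * B + c * Φ) := by
    have e1 := mul_le_mul_of_nonneg_right hk2 hB
    have e2 := mul_le_mul_of_nonneg_right hk3 hΦ0
    rw [hN, hE, hQ]
    linarith
  have hmain : (α k * A k - lam) * N ≥ α k * E := by
    have : (α k * A k - lam) * N = α k * E + (α k * A k - lam) * Φ := by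
      rw [hN]; field_simp
    rw [this]
    have := mul_nonneg hden.le hΦ0
    linarith
  -- perturbation
  have hFr : ∀ s, t₀ ≤ s → s ≤ T → ∃ ρ q : ℝ, α k ≤ ρ ∧ F k s = ρ * (-(A k) * z k s + q) ∧
      |q| ≤ E * Real.exp (-lam * (s - t₀)) := by
    intro s hs hsT
    obtain ⟨ρ, h, e, l, h1, h2, h3, h4, h5, h6, h7⟩ := hstr k s hs
    refine ⟨ρ, A k * (z k s - z k h) + e, h1, by rw [h7]; ring, ?_⟩
    have h8 := h6.trans (hu s hsT hs l h5)
    have h9 := mul_le_mul_of_nonneg_left (hdel h s hs hsT h3 h4) (hA k).le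
    refine (abs_add_le _ _).trans ?_
    rw [abs_mul, abs_of_pos (hA k), hE]
    linarith
  have hE0 : t₀ ≤ T → 0 ≤ E := by
    intro h
    obtain ⟨ρ, q, _, _, h3⟩ := hFr t₀ le_rfl h
    have := (abs_nonneg q).trans h3
    simpa using this
  have hgo : ∀ (y G : ℝ → ℝ), Continuous y →
      (∀ t, t₀ ≤ t → IntervalIntegrable G volume t₀ t) →
      (∀ t, t₀ ≤ t → y t = y t₀ + ∫ s in t₀..t, G s) → y t₀ ≤ Φ →
      (∀ s, t₀ ≤ s → s ≤ T → ∃ ρ q : ℝ, α k ≤ ρ ∧ G s = ρ * (-(A k) * y s + q) ∧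
        |q| ≤ E * Real.exp (-lam * (s - t₀))) →
      ∀ s, t₀ ≤ s → s ≤ T → y s ≤ N * Real.exp (-lam * (s - t₀)) := by
    intro y G hy hG hyG hy0 hGr s hs hsT
    have hEE := hE0 (hs.trans hsT)
    have hNpos : 0 ≤ N := by
      have := hα k
      positivity
    have hΦN : Φ ≤ N := by
      have : 0 ≤ α k / (α k * A k - lam) * E := by
        have := hα k
        positivity
      linarith
    refine aux_compare y G t₀ N lam hy hG hyG T (hy0.trans hΦN) ?_ s hs hsT
    intro v hv hvT hle
    obtain ⟨ρ, q, h1, h2, h3⟩ := hGr v hv hvT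
    rw [h2]
    set Y := Real.exp (-lam * (v - t₀)) with hY
    have hYpos : 0 < Y := Real.exp_pos _
    have h4 : -(A k) * y v + q ≤ -((A k * N - E) * Y) := by
      have := mul_le_mul_of_nonneg_left hle (hA k).le
      have := (le_abs_self q).trans h3
      linarith
    have h6 : lam * N ≤ α k * (A k * N - E) := by linarith
    have h5 : 0 ≤ A k * N - E := by
      have : 0 ≤ α k * (A k * N - E) := (mul_nonneg hlam.le hNpos).trans h6
      exact nonneg_of_mul_nonneg_right this (hα k)
    have hρ : 0 < ρ := lt_of_lt_of_le (hα k) h1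
    have h7 := mul_le_mul_of_nonneg_left h4 hρ.le
    have h8 := mul_le_mul_of_nonneg_right h1 (mul_nonneg h5 hYpos.le)
    have h9 := mul_le_mul_of_nonneg_right h6 hYpos.le
    linarith
  intro s hs hsT
  by_cases hst : t₀ ≤ s
  · have hexp : N * Real.exp (-lam * (s - t₀)) ≤
        d k * (θ * B + c * Φ) * Real.exp (-lam * (s - t₀)) :=
      mul_le_mul_of_nonneg_right hNle (Real.exp_pos _).le
    have hz0 := abs_le.1 (hΦ k t₀ (by linarith) le_rfl)
    refine (abs_le.2 ⟨?_, ?_⟩).trans hexp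
    · have := hgo (fun t => - z k t) (fun t => - F k t) (hz k).neg
        (fun t ht => (hF k t ht).neg)
        (fun t ht => by
          rw [intervalIntegral.integral_neg, hzF k t ht]; ring)
        (by linarith [hz0.1])
        (fun s hs hsT => by
          obtain ⟨ρ, q, h1, h2, h3⟩ := hFr s hs hsT
          exact ⟨ρ, -q, h1, by rw [h2]; ring, by rwa [abs_neg]⟩) s hst hsT
      linarith
    · exact hgo (z k) (F k) (hz k) (hF k) (hzF k) hz0.2 hFr s hst hsT
  · push Not at hst
    have h1 := hΦ k s hs hst.le
    have h2 : (1:ℝ) ≤ Real.exp (-lam * (s - t₀)) := by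
      apply Real.one_le_exp
      nlinarith
    -- here only the history bound is needed
    have h3 : Φ ≤ d k * (c * Φ) := by
      have e2 := mul_le_mul_of_nonneg_right hk3 hΦ0
      have e3 : 0 ≤ α k / (α k * A k - lam) * (A k * (2 * X)) * Φ := by
        have := hα k
        have := hA k
        positivity
      linarith
    have h4 : 0 ≤ d k * (θ * B) := by
      have hθ : 0 ≤ θ * d k := by
        refine le_trans ?_ hk2
        have hR1 : 0 ≤ R k := by
          obtain ⟨ρ, _, _, _, g1, g2, _⟩ := hstr k t₀ le_rfl
          linarith [hα k]
        have hτ1 : 0 ≤ τ k := by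
          obtain ⟨ρ, _, _, _, g1, g2, g3, g4, _⟩ := hstr k t₀ le_rfl
          linarith
        have := hα k
        have := hA k
        have := hd k
        positivity
      have := mul_nonneg hθ hB
      linarith
    have h5 : Φ ≤ d k * (θ * B + c * Φ) := by linarith
    calc |z k s| ≤ Φ := h1
      _ ≤ d k * (θ * B + c * Φ) := h5
      _ ≤ _ := le_mul_of_one_le_right (hΦ0.trans h5) h2

/-- Exponential stability for the abstract delayed inequality system. -/
lemma aux_core {ι : Type*} [Fintype ι] [Nonempty ι] (A α R τ d : ι → ℝ) (w : ι → ι → ℝ) (H : ℝ)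
    (hH : 0 ≤ H)
    (hA : ∀ k, 0 < A k) (hα : ∀ k, 0 < α k) (hd : ∀ k, 0 < d k)
    (hw : ∀ k j, 0 ≤ w k j) (hτH : ∀ k, τ k ≤ H)
    (hsmall : ∀ k, τ k * R k * (A k * d k + ∑ j, w k j * d j) + (∑ j, w k j * d j) / A k < d k) :
    ∃ M Λ : ℝ, 0 < M ∧ 0 < Λ ∧ ∀ (t₀ : ℝ) (z F : ι → ℝ → ℝ), 0 ≤ t₀ → (∀ k, Continuous (z k)) →
      (∀ k t, t₀ ≤ t → IntervalIntegrable (F k) volume t₀ t) →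
      (∀ k t, t₀ ≤ t → z k t = z k t₀ + ∫ s in t₀..t, F k s) →
      (∀ k s, t₀ ≤ s → ∃ (ρ h e : ℝ) (l : ι → ℝ), α k ≤ ρ ∧ ρ ≤ R k ∧ 0 ≤ s - h ∧
        s - h ≤ τ k ∧ (∀ j, 0 ≤ s - l j ∧ s - l j ≤ H) ∧ |e| ≤ ∑ j, w k j * |z j (l j)| ∧
        F k s = ρ * (-(A k) * z k h + e)) →
      ∀ Φ : ℝ, (∀ k s, t₀ - H ≤ s → s ≤ t₀ → |z k s| ≤ Φ) →
      ∀ k t, t₀ ≤ t → |z k t| ≤ M * Real.exp (-Λ * (t - t₀)) * Φ := by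
  obtain ⟨lam, θ, c, hlam, hθ1, hθ0, hc, hch⟩ :=
    aux_choice A α R τ d (fun k => ∑ j, w k j * d j) H hA hα hd hsmall
  obtain ⟨km, hkm⟩ := Finite.exists_max d
  have hθ' : 0 < 1 - θ := sub_pos.2 hθ1
  refine ⟨d km * (c / (1 - θ)), lam, mul_pos (hd km) (div_pos hc hθ'), hlam, ?_⟩
  intro t₀ z F ht0 hz hF hzF hstr Φ hΦ k t ht
  have hΦ0 : 0 ≤ Φ := (abs_nonneg _).trans (hΦ k t₀ (by linarith) le_rfl)
  set D := c * Φ / (1 - θ) with hD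
  have hD0 : 0 ≤ D := by positivity
  have hDeq : θ * D + c * Φ = D := by rw [hD]; field_simp; ring
  -- some initial bound
  have hstart : ∃ B0 : ℝ, 0 ≤ B0 ∧ ∀ k s, t₀ - H ≤ s → s ≤ t →
      |z k s| ≤ d k * B0 * Real.exp (-lam * (s - t₀)) := by
    have : ∀ k, ∃ b : ℝ, ∀ s ∈ Set.Icc (t₀ - H) t,
        ‖|z k s| / (d k * Real.exp (-lam * (s - t₀)))‖ ≤ b := by
      intro k
      apply isCompact_Icc.exists_bound_of_continuousOn
      apply Continuous.continuousOn
      apply Continuous.div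
      · exact (hz k).abs
      · fun_prop
      · intro s
        have := hd k
        positivity
    choose b hb using this
    obtain ⟨kb, hkb⟩ := Finite.exists_max b
    refine ⟨max 0 (b kb), le_max_left _ _, ?_⟩
    intro k s hs1 hs2
    have h1 := hb k s ⟨hs1, hs2⟩
    have h2 : |z k s| / (d k * Real.exp (-lam * (s - t₀))) ≤ max 0 (b kb) :=
      (le_abs_self _).trans (h1.trans ((hkb k).trans (le_max_right _ _)))
    rw [div_le_iff₀ (mul_pos (hd k) (Real.exp_pos _))] at h2
    linarith
  obtain ⟨B0, hB0, hbd0⟩ := hstart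
  have hiter : ∀ m : ℕ, ∀ k s, t₀ - H ≤ s → s ≤ t →
      |z k s| ≤ d k * (θ ^ m * B0 + D) * Real.exp (-lam * (s - t₀)) := by
    intro m
    induction m with
    | zero =>
      intro k s h1 h2
      refine (hbd0 k s h1 h2).trans ?_
      apply mul_le_mul_of_nonneg_right _ (Real.exp_pos _).le
      apply mul_le_mul_of_nonneg_left _ (hd k).le
      simp [hD0]
    | succ m ih =>
      have := aux_step A α R τ d (fun k => ∑ j, w k j * d j) w H hH hA hα hd hw (fun _ => rfl) hτH
        lam θ c hlam hch t₀ z F hz hF hzF hstr Φ hΦ t (θ ^ m * B0 + D) (by positivity) hΦ0 ih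
      intro k s h1 h2
      have h3 := this k s h1 h2
      have h4 : θ * (θ ^ m * B0 + D) + c * Φ = θ ^ (m + 1) * B0 + D := by
        linear_combination hDeq
      rwa [h4] at h3
  have hlim : Filter.Tendsto (fun m : ℕ => d k * (θ ^ m * B0 + D) * Real.exp (-lam * (t - t₀)))
      Filter.atTop (nhds (d k * (0 * B0 + D) * Real.exp (-lam * (t - t₀)))) :=
    ((((tendsto_pow_atTop_nhds_zero_of_lt_one hθ0 hθ1).mul_const B0).add_const D).const_mul
      (d k)).mul_const _
  have hfin := ge_of_tendsto' hlim (fun m => hiter m k t (by linarith) le_rfl)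
  rw [zero_mul, zero_add] at hfin
  refine hfin.trans ?_
  have : d k * D * Real.exp (-lam * (t - t₀)) ≤ d km * D * Real.exp (-lam * (t - t₀)) :=
    mul_le_mul_of_nonneg_right (mul_le_mul_of_nonneg_right (hkm k) hD0) (Real.exp_pos _).le
  refine this.trans (le_of_eq ?_)
  rw [hD]; ring

/-- The row condition of the M-matrix implies the smallness used in `aux_core`. -/
lemma aux_row (A α R τ d W : ℝ) (hA : 0 < A) (hα : 0 < α) (hR : α ≤ R) (hτ : 0 ≤ τ) (hd : 0 < d)
    (hW : 0 ≤ W)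
    (h : 0 < (1 - A * R ^ 2 * τ / α) * d - W * (R * (A * R * τ + 1) / (α * A))) :
    τ * R * (A * d + W) + W / A < d := by
  have hq : 1 ≤ R / α := (one_le_div hα).2 hR
  have h1 : (1 - A * R ^ 2 * τ / α) * d - W * (R * (A * R * τ + 1) / (α * A))
      = d - R / α * (τ * R * (A * d + W) + W / A) := by
    field_simp
    ring
  rw [h1] at h
  have h2 : 0 ≤ τ * R * (A * d + W) + W / A := by
    have : 0 < R := hα.trans_le hR
    positivity
  nlinarith

/-- Theorem 3.6: if the matrix `C_BAM` is a nonsingular M-matrix, then the equilibrium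
`(x*, y*)` of the non-autonomous BAM neural network system (22) is globally exponentially
stable. -/
theorem stmt14
    (n : ℕ) (hn : 0 < n)
    (r p : Fin n → ℝ → ℝ) (α R β P : Fin n → ℝ)
    (a b : Fin n → ℝ) (aij bij : Fin n → Fin n → ℝ) (I J : Fin n → ℝ)
    (f g : Fin n → ℝ → ℝ) (Lf Lg : Fin n → ℝ)
    (h₁ h₂ l₁ l₂ : Fin n → ℝ → ℝ)
    (τ₁ τ₂ σ₁ σ₂ : Fin n → ℝ)
    -- (b1)
    (hr_meas : ∀ i, Measurable (r i)) (hp_meas : ∀ i, Measurable (p i))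
    (hα : ∀ i, 0 < α i) (hβ : ∀ i, 0 < β i)
    (hr_bd : ∀ i t, 0 ≤ t → α i ≤ r i t ∧ r i t ≤ R i)
    (hp_bd : ∀ i t, 0 ≤ t → β i ≤ p i t ∧ p i t ≤ P i)
    -- (b2)
    (hf_cont : ∀ j, Continuous (f j)) (hg_cont : ∀ j, Continuous (g j))
    (hf_lip : ∀ j u v, |f j u - f j v| ≤ Lf j * |u - v|)
    (hg_lip : ∀ j u v, |g j u - g j v| ≤ Lg j * |u - v|)
    -- (b3)
    (hh₁_meas : ∀ i, Measurable (h₁ i)) (hh₂_meas : ∀ i, Measurable (h₂ i))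
    (hl₁_meas : ∀ i, Measurable (l₁ i)) (hl₂_meas : ∀ i, Measurable (l₂ i))
    (hh₁ : ∀ i t, 0 ≤ t → 0 ≤ t - h₁ i t ∧ t - h₁ i t ≤ τ₁ i)
    (hh₂ : ∀ i t, 0 ≤ t → 0 ≤ t - h₂ i t ∧ t - h₂ i t ≤ τ₂ i)
    (hl₁ : ∀ i t, 0 ≤ t → 0 ≤ t - l₁ i t ∧ t - l₁ i t ≤ σ₁ i)
    (hl₂ : ∀ i t, 0 ≤ t → 0 ≤ t - l₂ i t ∧ t - l₂ i t ≤ σ₂ i)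
    (ha : ∀ i, 0 < a i) (hb : ∀ i, 0 < b i)
    -- the equilibrium
    (xs ys : Fin n → ℝ)
    (hxs : ∀ i, a i * xs i = ∑ j, aij i j * f j (ys j) + I i)
    (hys : ∀ i, b i * ys i = ∑ j, bij i j * g j (xs j) + J i)
    -- the matrix C_BAM of (25), (26)
    (C : Matrix (Fin n ⊕ Fin n) (Fin n ⊕ Fin n) ℝ)
    (hC₁₁ : ∀ i i', C (Sum.inl i) (Sum.inl i') =
      if i = i' then 1 - a i * R i ^ 2 * τ₁ i / α i else 0)
    (hC₂₂ : ∀ i i', C (Sum.inr i) (Sum.inr i') =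
      if i = i' then 1 - b i * P i ^ 2 * τ₂ i / β i else 0)
    (hC₁₂ : ∀ i j, C (Sum.inl i) (Sum.inr j) =
      -(|aij i j| * R i * Lf j * (a i * R i * τ₁ i + 1)) / (α i * a i))
    (hC₂₁ : ∀ i j, C (Sum.inr i) (Sum.inl j) =
      -(|bij i j| * P i * Lg j * (b i * P i * τ₂ i + 1)) / (β i * b i))
    -- C_BAM is a nonsingular M-matrix
    (hC_offdiag : ∀ k k', k ≠ k' → C k k' ≤ 0)
    (hC_unit : IsUnit C.det)
    (hC_invpos : ∀ k k', 0 < C⁻¹ k k') :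
    -- global exponential stability of the equilibrium
    ∃ M Λ : ℝ, 0 < M ∧ 0 < Λ ∧
      ∀ t₀ : ℝ, 0 ≤ t₀ → ∀ x y : Fin n → ℝ → ℝ,
        (∀ i, Continuous (x i)) → (∀ i, Continuous (y i)) →
        (∀ i t, t₀ ≤ t → IntervalIntegrable
            (fun s => r i s * (-(a i) * x i (h₁ i s) +
              ∑ j, aij i j * f j (y j (l₂ j s)) + I i)) volume t₀ t) →
        (∀ i t, t₀ ≤ t → IntervalIntegrable
            (fun s => p i s * (-(b i) * y i (h₂ i s) +
              ∑ j, bij i j * g j (x j (l₁ j s)) + J i)) volume t₀ t) →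
        (∀ i t, t₀ ≤ t →
          x i t = x i t₀ + ∫ s in t₀..t,
            r i s * (-(a i) * x i (h₁ i s) +
              ∑ j, aij i j * f j (y j (l₂ j s)) + I i)) →
        (∀ i t, t₀ ≤ t →
          y i t = y i t₀ + ∫ s in t₀..t,
            p i s * (-(b i) * y i (h₂ i s) +
              ∑ j, bij i j * g j (x j (l₁ j s)) + J i)) →
        ∀ t, t₀ ≤ t →
          ‖((fun i => x i t - xs i, fun i => y i t - ys i) : (Fin n → ℝ) × (Fin n → ℝ))‖ ≤
            M * Real.exp (-Λ * (t - t₀)) *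
              (‖((fun i => x i t₀ - xs i, fun i => y i t₀ - ys i) :
                  (Fin n → ℝ) × (Fin n → ℝ))‖ +
                sSup ((fun s =>
                    ‖((fun i => x i s - xs i, fun i => y i s - ys i) :
                      (Fin n → ℝ) × (Fin n → ℝ))‖) ''
                  Set.Icc (t₀ - max (max (⨆ i, τ₁ i) (⨆ i, τ₂ i))
                    (max (⨆ i, σ₁ i) (⨆ i, σ₂ i))) t₀)) := by
  set H : ℝ := max (max (⨆ i, τ₁ i) (⨆ i, τ₂ i)) (max (⨆ i, σ₁ i) (⨆ i, σ₂ i)) with hHdef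
  have hsup : ∀ (q : Fin n → ℝ) i, q i ≤ ⨆ i, q i :=
    fun q i => le_ciSup (Set.finite_range q).bddAbove i
  have hτ₁H : ∀ i, τ₁ i ≤ H := fun i =>
    (hsup τ₁ i).trans ((le_max_left _ _).trans (le_max_left _ _))
  have hτ₂H : ∀ i, τ₂ i ≤ H := fun i =>
    (hsup τ₂ i).trans ((le_max_right _ _).trans (le_max_left _ _))
  have hσ₁H : ∀ i, σ₁ i ≤ H := fun i =>
    (hsup σ₁ i).trans ((le_max_left _ _).trans (le_max_right _ _))
  have hσ₂H : ∀ i, σ₂ i ≤ H := fun i =>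
    (hsup σ₂ i).trans ((le_max_right _ _).trans (le_max_right _ _))
  have hτ₁0 : ∀ i, 0 ≤ τ₁ i := fun i => (hh₁ i 0 le_rfl).1.trans (hh₁ i 0 le_rfl).2
  have hτ₂0 : ∀ i, 0 ≤ τ₂ i := fun i => (hh₂ i 0 le_rfl).1.trans (hh₂ i 0 le_rfl).2
  have hH : 0 ≤ H := (hτ₁0 ⟨0, hn⟩).trans (hτ₁H ⟨0, hn⟩)
  have hαR : ∀ i, α i ≤ R i := fun i => (hr_bd i 0 le_rfl).1.trans (hr_bd i 0 le_rfl).2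
  have hβP : ∀ i, β i ≤ P i := fun i => (hp_bd i 0 le_rfl).1.trans (hp_bd i 0 le_rfl).2
  have hLf : ∀ j, 0 ≤ Lf j := fun j => by
    have := (abs_nonneg _).trans (hf_lip j 1 0)
    simpa using this
  have hLg : ∀ j, 0 ≤ Lg j := fun j => by
    have := (abs_nonneg _).trans (hg_lip j 1 0)
    simpa using this
  have : Nonempty (Fin n) := ⟨⟨0, hn⟩⟩
  -- positive weight vector
  set d : Fin n ⊕ Fin n → ℝ := C⁻¹.mulVec (fun _ => 1) with hddef
  have hd : ∀ k, 0 < d k := by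
    intro k
    simp only [hddef, Matrix.mulVec, dotProduct, mul_one]
    exact Finset.sum_pos (fun j _ => hC_invpos k j) Finset.univ_nonempty
  have hCd : C.mulVec d = fun _ => 1 := by
    rw [hddef, Matrix.mulVec_mulVec, Matrix.mul_nonsing_inv _ hC_unit, Matrix.one_mulVec]
  set w : Fin n ⊕ Fin n → Fin n ⊕ Fin n → ℝ :=
    Sum.elim (fun i => Sum.elim (fun _ => 0) (fun j => |aij i j| * Lf j))
      (fun i => Sum.elim (fun j => |bij i j| * Lg j) (fun _ => 0)) with hwdef
  have hw : ∀ k j, 0 ≤ w k j := by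
    rintro (i | i) (j | j) <;> simp only [hwdef, Sum.elim_inl, Sum.elim_inr, le_refl]
    · exact mul_nonneg (abs_nonneg _) (hLf j)
    · exact mul_nonneg (abs_nonneg _) (hLg j)
  have hsmall : ∀ k, (Sum.elim τ₁ τ₂ : _ → ℝ) k * (Sum.elim R P : _ → ℝ) k *
      ((Sum.elim a b : _ → ℝ) k * d k + ∑ j, w k j * d j) +
      (∑ j, w k j * d j) / (Sum.elim a b : _ → ℝ) k < d k := by
    have hWnn : ∀ k, 0 ≤ ∑ j, w k j * d j := fun k =>
      Finset.sum_nonneg fun j _ => mul_nonneg (hw k j) (hd j).le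
    rintro (i | i)
    · refine aux_row (a i) (α i) (R i) (τ₁ i) (d (Sum.inl i)) _ (ha i) (hα i) (hαR i) (hτ₁0 i)
        (hd _) (hWnn _) ?_
      have h1 := congrFun hCd (Sum.inl i)
      simp only [Matrix.mulVec, dotProduct, Fintype.sum_sum_type, hC₁₁, hC₁₂, ite_mul, zero_mul,
        Finset.sum_ite_eq, Finset.mem_univ, if_true] at h1
      have h2 : ∑ j, -(|aij i j| * R i * Lf j * (a i * R i * τ₁ i + 1)) / (α i * a i) * d (Sum.inr j)
          = -((∑ j, w (Sum.inl i) j * d j) * (R i * (a i * R i * τ₁ i + 1) / (α i * a i))) := by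
        simp only [Fintype.sum_sum_type, hwdef, Sum.elim_inl, Sum.elim_inr, zero_mul,
          Finset.sum_const_zero, zero_add]
        rw [Finset.sum_mul, ← Finset.sum_neg_distrib]
        exact Finset.sum_congr rfl fun j _ => by ring
      rw [h2] at h1
      linarith
    · refine aux_row (b i) (β i) (P i) (τ₂ i) (d (Sum.inr i)) _ (hb i) (hβ i) (hβP i) (hτ₂0 i)
        (hd _) (hWnn _) ?_
      have h1 := congrFun hCd (Sum.inr i)
      simp only [Matrix.mulVec, dotProduct, Fintype.sum_sum_type, hC₂₂, hC₂₁, ite_mul, zero_mul,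
        Finset.sum_ite_eq, Finset.mem_univ, if_true] at h1
      have h2 : ∑ j, -(|bij i j| * P i * Lg j * (b i * P i * τ₂ i + 1)) / (β i * b i) * d (Sum.inl j)
          = -((∑ j, w (Sum.inr i) j * d j) * (P i * (b i * P i * τ₂ i + 1) / (β i * b i))) := by
        simp only [Fintype.sum_sum_type, hwdef, Sum.elim_inl, Sum.elim_inr, zero_mul,
          Finset.sum_const_zero, add_zero]
        rw [Finset.sum_mul, ← Finset.sum_neg_distrib]
        exact Finset.sum_congr rfl fun j _ => by ring
      rw [h2] at h1
      linarith
  obtain ⟨M, Λ, hM, hΛ, hcore⟩ := aux_core (Sum.elim a b) (Sum.elim α β) (Sum.elim R P)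
    (Sum.elim τ₁ τ₂) d w H hH
    (by rintro (i | i); exacts [ha i, hb i]) (by rintro (i | i); exacts [hα i, hβ i]) hd hw
    (by rintro (i | i); exacts [hτ₁H i, hτ₂H i]) hsmall
  refine ⟨M, Λ, hM, hΛ, ?_⟩
  intro t₀ ht₀ x y hx hy hIx hIy hxeq hyeq t ht
  set nrm : ℝ → ℝ := fun s => ‖((fun i => x i s - xs i, fun i => y i s - ys i) :
      (Fin n → ℝ) × (Fin n → ℝ))‖ with hnrm
  have hnc : Continuous nrm := by
    rw [hnrm]
    apply Continuous.norm
    apply Continuous.prodMk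
    · exact continuous_pi fun i => (hx i).sub continuous_const
    · exact continuous_pi fun i => (hy i).sub continuous_const
  set z : Fin n ⊕ Fin n → ℝ → ℝ :=
    Sum.elim (fun i s => x i s - xs i) (fun i s => y i s - ys i) with hzdef
  have hzn : ∀ k s, |z k s| ≤ nrm s := by
    rintro (i | i) s
    · exact (norm_le_pi_norm (fun i => x i s - xs i) i).trans (le_max_left _ _)
    · exact (norm_le_pi_norm (fun i => y i s - ys i) i).trans (le_max_right _ _)
  change nrm t ≤ M * Real.exp (-Λ * (t - t₀)) *
    (nrm t₀ + sSup (nrm '' Set.Icc (t₀ - H) t₀))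
  set Φ := nrm t₀ + sSup (nrm '' Set.Icc (t₀ - H) t₀) with hΦdef
  have hΦ : ∀ k s, t₀ - H ≤ s → s ≤ t₀ → |z k s| ≤ Φ := by
    intro k s h1 h2
    have h3 : nrm s ≤ sSup (nrm '' Set.Icc (t₀ - H) t₀) :=
      le_csSup (isCompact_Icc.image hnc).bddAbove ⟨s, ⟨h1, h2⟩, rfl⟩
    have h4 : 0 ≤ nrm t₀ := norm_nonneg _
    have := hzn k s
    linarith
  have hall := hcore t₀ z (Sum.elim
      (fun i s => r i s * (-(a i) * x i (h₁ i s) + ∑ j, aij i j * f j (y j (l₂ j s)) + I i))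
      (fun i s => p i s * (-(b i) * y i (h₂ i s) + ∑ j, bij i j * g j (x j (l₁ j s)) + J i)))
    ht₀
    (by rintro (i | i)
        · exact (hx i).sub continuous_const
        · exact (hy i).sub continuous_const)
    (by rintro (i | i) t ht
        · exact hIx i t ht
        · exact hIy i t ht)
    (by rintro (i | i) t ht
        · simp only [hzdef, Sum.elim_inl]
          rw [hxeq i t ht]; ring
        · simp only [hzdef, Sum.elim_inr]
          rw [hyeq i t ht]; ring)
    (by
      rintro (i | i) s hs
      · have hs0 : 0 ≤ s := ht₀.trans hs
        refine ⟨r i s, h₁ i s, ∑ j, aij i j * (f j (y j (l₂ j s)) - f j (ys j)),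
          Sum.elim (fun j => l₁ j s) (fun j => l₂ j s), (hr_bd i s hs0).1, (hr_bd i s hs0).2,
          (hh₁ i s hs0).1, (hh₁ i s hs0).2, ?_, ?_, ?_⟩
        · rintro (j | j)
          · exact ⟨(hl₁ j s hs0).1, (hl₁ j s hs0).2.trans (hσ₁H j)⟩
          · exact ⟨(hl₂ j s hs0).1, (hl₂ j s hs0).2.trans (hσ₂H j)⟩
        · simp only [Fintype.sum_sum_type, hwdef, hzdef, Sum.elim_inl, Sum.elim_inr, zero_mul,
            Finset.sum_const_zero, zero_add]
          refine (Finset.abs_sum_le_sum_abs _ _).trans (Finset.sum_le_sum fun j _ => ?_)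
          rw [abs_mul, mul_assoc]
          exact mul_le_mul_of_nonneg_left (hf_lip j _ _) (abs_nonneg _)
        · simp only [hzdef, Sum.elim_inl, mul_sub, Finset.sum_sub_distrib]
          have := hxs i
          linear_combination (-(r i s)) * this
      · have hs0 : 0 ≤ s := ht₀.trans hs
        refine ⟨p i s, h₂ i s, ∑ j, bij i j * (g j (x j (l₁ j s)) - g j (xs j)),
          Sum.elim (fun j => l₁ j s) (fun j => l₂ j s), (hp_bd i s hs0).1, (hp_bd i s hs0).2,
          (hh₂ i s hs0).1, (hh₂ i s hs0).2, ?_, ?_, ?_⟩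
        · rintro (j | j)
          · exact ⟨(hl₁ j s hs0).1, (hl₁ j s hs0).2.trans (hσ₁H j)⟩
          · exact ⟨(hl₂ j s hs0).1, (hl₂ j s hs0).2.trans (hσ₂H j)⟩
        · simp only [Fintype.sum_sum_type, hwdef, hzdef, Sum.elim_inl, Sum.elim_inr, zero_mul,
            Finset.sum_const_zero, add_zero]
          refine (Finset.abs_sum_le_sum_abs _ _).trans (Finset.sum_le_sum fun j _ => ?_)
          rw [abs_mul, mul_assoc]
          exact mul_le_mul_of_nonneg_left (hg_lip j _ _) (abs_nonneg _)
        · simp only [hzdef, Sum.elim_inr, mul_sub, Finset.sum_sub_distrib]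
          have := hys i
          linear_combination (-(p i s)) * this)
    Φ hΦ
  have hnn : 0 ≤ M * Real.exp (-Λ * (t - t₀)) * Φ :=
    (abs_nonneg _).trans (hall (Sum.inl ⟨0, hn⟩) t ht)
  refine max_le ?_ ?_
  · exact (pi_norm_le_iff_of_nonneg hnn).2 fun i => hall (Sum.inl i) t ht
  · exact (pi_norm_le_iff_of_nonneg hnn).2 fun i => hall (Sum.inr i) t ht
end

section
/- Suppose h_i^(1)(t) ≡ t and h_i^(2)(t) ≡ t (no leakage delays), and at least one of the following conditions holds: (1) Σ_{j=1}^n |a_ij| R_i L_j^f/(α_i a_i) < 1 and Σ_{j=1}^n |b_ij| P_i L_j^g/(β_i b_i) < 1 for all i = 1,…,n; (2) Σ_{i=1}^n |a_ij| R_i L_j^f/(α_i a_i) < 1 and Σ_{i=1}^n |b_ij| P_i L_j^g/(β_i b_i) < 1 for all j = 1,…,n; (3) there exist positive numbers μ_k, k = 1,…,2n, such that Σ_{j=1}^n μ_{j+n} |a_ij| R_i L_j^f/(α_i a_i) < μ_i and Σ_{j=1}^n μ_j |b_ij| P_i L_j^g/(β_i b_i) < μ_{i+n} for all i = 1,…,n;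 (4) there exist positive numbers μ_k, k = 1,…,2n, such that Σ_{i=1}^n μ_{i+n} |a_ij| R_i L_j^f/(α_i a_i) < μ_j and Σ_{i=1}^n μ_i |b_ij| P_i L_j^g/(β_i b_i) < μ_{j+n} for all j = 1,…,n. Then the equilibrium (x*, y*) of the BAM system is globally exponentially stable. -/
open MeasureTheory

open Filter Topology in
lemma bam_core {ι : Type*} [Fintype ι] (α a ξ : ι → ℝ) (c : ι → ι → ℝ) (S lam : ℝ)
    (hα : ∀ k, 0 < α k) (hc : ∀ k m, 0 ≤ c k m) (hξ : ∀ k, 0 < ξ k)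
    (hlam : 0 < lam)
    (hrate : ∀ k, lam * ξ k / α k + Real.exp (lam * S) * ∑ m, c k m * ξ m < a k * ξ k)
    (t₀ : ℝ) (z u l : ι → ℝ → ℝ) (hz : ∀ k, Continuous (z k))
    (hui : ∀ k t, t₀ ≤ t → IntervalIntegrable (u k) volume t₀ t)
    (hu : ∀ k t, t₀ ≤ t → z k t = z k t₀ + ∫ s in t₀..t, u k s)
    (huF : ∀ k s, t₀ ≤ s → ∃ ρ F : ℝ, α k ≤ ρ ∧ u k s = ρ * (-(a k) * z k s + F) ∧
      |F| ≤ ∑ m, c k m * |z m (l m s)|)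
    (hl : ∀ m s, t₀ ≤ s → 0 ≤ s - l m s ∧ s - l m s ≤ S)
    (hS : 0 ≤ S)
    (K : ℝ) (hK : 0 < K) (hist : ∀ m s, t₀ - S ≤ s → s ≤ t₀ → |z m s| < K * ξ m) :
    ∀ t, t₀ ≤ t → ∀ k, |z k t| ≤ K * ξ k * Real.exp (-lam * (t - t₀)) := by
  by_contra hcon
  push Not at hcon
  obtain ⟨t1, ht1, k1, hk1⟩ := hcon
  set w : ι → ℝ → ℝ := fun k t => K * ξ k * Real.exp (-lam * (t - t₀)) with hw
  have hwc : ∀ k, Continuous (w k) := fun k => by simp only [hw]; fun_prop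
  set B : Set ℝ := Set.Ici t₀ ∩ ⋃ k, {t | w k t ≤ |z k t|} with hB
  have hBc : IsClosed B := by
    refine isClosed_Ici.inter (isClosed_iUnion_of_finite fun k => ?_)
    exact isClosed_le (hwc k) (hz k).abs
  have hBne : B.Nonempty := ⟨t1, ht1, Set.mem_iUnion.2 ⟨k1, hk1.le⟩⟩
  have hBb : BddBelow B := ⟨t₀, fun t ht => ht.1⟩
  set T := sInf B with hT
  have hTB : T ∈ B := hBc.csInf_mem hBne hBb
  have hlt : ∀ s, t₀ ≤ s → s < T → ∀ m, |z m s| < w m s := by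
    intro s hs hsT m
    by_contra h
    exact absurd (csInf_le hBb (show s ∈ B from ⟨hs, Set.mem_iUnion.2 ⟨m, not_lt.1 h⟩⟩))
      (not_le.2 hsT)
  obtain ⟨hT0, hTu⟩ := hTB
  obtain ⟨k, hk⟩ := Set.mem_iUnion.1 hTu
  have hk : w k T ≤ |z k T| := hk
  have hTlt : t₀ < T := by
    rcases lt_or_eq_of_le (show t₀ ≤ T from hT0) with h | h
    · exact h
    · exfalso
      rw [← h] at hk
      have := hist k t₀ (by linarith) le_rfl
      simp [hw] at hk
      linarith
  -- bound at all earlier times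
  have hall : ∀ s, t₀ - S ≤ s → s < T → ∀ m, |z m s| ≤ w m s := by
    intro s hs hsT m
    rcases le_total t₀ s with h | h
    · exact (hlt s h hsT m).le
    · refine (hist m s hs h).le.trans ?_
      have h1 : 1 ≤ Real.exp (-lam * (s - t₀)) := Real.one_le_exp (by nlinarith)
      exact le_mul_of_one_le_right (mul_pos hK (hξ m)).le h1
  obtain ⟨e, he, he1⟩ : ∃ e : ℝ, |z k T| = e * z k T ∧ |e| = 1 := by
    rcases abs_choice (z k T) with h | h
    · exact ⟨1, by rw [h]; ring, by simp⟩
    · exact ⟨-1, by rw [h]; ring, by simp⟩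
  set E : ℝ → ℝ := fun s => Real.exp (-lam * (s - t₀)) with hE
  have hEc : Continuous E := by simp only [hE]; fun_prop
  have hEpos : ∀ s, 0 < E s := fun s => Real.exp_pos _
  set Q := ∑ m, c k m * ξ m with hQ
  have hak : 0 < a k := by
    have h1 : 0 ≤ Q := Finset.sum_nonneg fun m _ => mul_nonneg (hc k m) (hξ m).le
    have h2 : 0 < lam * ξ k / α k := div_pos (mul_pos hlam (hξ k)) (hα k)
    have h3 := hrate k
    have h4 : 0 ≤ Real.exp (lam * S) * Q := mul_nonneg (Real.exp_pos _).le h1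
    have h5 : 0 < a k * ξ k := by linarith
    exact pos_of_mul_pos_left h5 (hξ k).le
  set G : ℝ → ℝ := fun s => -(a k) * (e * z k s) + Real.exp (lam * S) * Q * K * E s
    + lam * ξ k / α k * K * E s with hG
  have hGc : Continuous G := by
    have := hz k
    simp only [hG]; fun_prop
  have hGT : G T < 0 := by
    have h1 : K * ξ k * E T ≤ e * z k T := he ▸ hk
    have h2 := mul_le_mul_of_nonneg_left h1 hak.le
    have h3 := mul_lt_mul_of_pos_right (hrate k) (mul_pos hK (hEpos T))
    simp only [hG]
    nlinarith
  have hev : ∀ᶠ s in 𝓝 T, G s < 0 := hGc.continuousAt.eventually_lt_const hGT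
  obtain ⟨δ, hδ, hball⟩ := Metric.eventually_nhds_iff.1 hev
  set s0 := max t₀ (T - δ / 2) with hs0
  have hs0t : t₀ ≤ s0 := le_max_left _ _
  have hs0T : s0 < T := max_lt hTlt (by linarith)
  have hGneg : ∀ s ∈ Set.Ioo s0 T, G s < 0 := by
    intro s hs
    apply hball
    have : T - δ / 2 ≤ s0 := le_max_right _ _
    rw [Real.dist_eq, abs_lt]
    constructor <;> linarith [hs.1, hs.2]
  have huii : IntervalIntegrable (u k) volume s0 T :=
    (hui k s0 hs0t).symm.trans (hui k T hTlt.le)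
  have hderiv : ∀ s, HasDerivAt (w k) (K * ξ k * (E s * (-lam))) s := by
    intro s
    have h1 : HasDerivAt (fun s => -lam * (s - t₀)) (-lam) s := by
      simpa using ((hasDerivAt_id s).sub_const t₀).const_mul (-lam)
    exact (h1.exp).const_mul _
  have hwc' : Continuous fun s => K * ξ k * (E s * (-lam)) := by fun_prop
  have hwint : ∫ s in s0..T, K * ξ k * (E s * (-lam)) = w k T - w k s0 :=
    intervalIntegral.integral_eq_sub_of_hasDerivAt (fun s _ => hderiv s)
      (hwc'.intervalIntegrable _ _)
  have hmono : ∫ s in s0..T, e * u k s ≤ ∫ s in s0..T, K * ξ k * (E s * (-lam)) := by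
    refine intervalIntegral.integral_mono_on_of_le_Ioo hs0T.le (huii.const_mul e)
      (hwc'.intervalIntegrable _ _) ?_
    intro s hs
    have hst : t₀ ≤ s := hs0t.trans hs.1.le
    obtain ⟨ρ, F, hρ, hus, hF⟩ := huF k s hst
    have hF2 : |F| ≤ Real.exp (lam * S) * Q * K * E s := by
      refine hF.trans ?_
      have : Real.exp (lam * S) * Q * K * E s
          = ∑ m, c k m * (K * ξ m * (Real.exp (lam * S) * E s)) := by
        rw [hQ, Finset.mul_sum, Finset.sum_mul, Finset.sum_mul]
        exact Finset.sum_congr rfl fun m _ => by ring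
      rw [this]
      refine Finset.sum_le_sum fun m _ => mul_le_mul_of_nonneg_left ?_ (hc k m)
      obtain ⟨hl1, hl2⟩ := hl m s hst
      refine (hall (l m s) (by linarith) (by linarith [hs.2]) m).trans ?_
      refine mul_le_mul_of_nonneg_left ?_ (mul_pos hK (hξ m)).le
      rw [hE, ← Real.exp_add]
      apply Real.exp_le_exp.2
      nlinarith
    have heF : e * F ≤ |F| := by
      calc e * F ≤ |e * F| := le_abs_self _
        _ = |F| := by rw [abs_mul, he1, one_mul]
    have hG1 := hGneg s hs
    simp only [hG] at hG1
    have hX : -(a k) * (e * z k s) + e * F ≤ -(lam * ξ k / α k * K * E s) := by linarith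
    have hpos : 0 < lam * ξ k / α k * K * E s :=
      mul_pos (mul_pos (div_pos (mul_pos hlam (hξ k)) (hα k)) hK) (hEpos s)
    calc e * u k s = ρ * (-(a k) * (e * z k s) + e * F) := by rw [hus]; ring
      _ ≤ ρ * -(lam * ξ k / α k * K * E s) :=
        mul_le_mul_of_nonneg_left hX ((hα k).le.trans hρ)
      _ ≤ α k * -(lam * ξ k / α k * K * E s) := by nlinarith
      _ = K * ξ k * (E s * (-lam)) := by
        have := (hα k).ne'
        field_simp
  have hdiff : e * z k T - e * z k s0 = ∫ s in s0..T, e * u k s := by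
    rw [intervalIntegral.integral_const_mul, hu k T hTlt.le, hu k s0 hs0t,
      ← intervalIntegral.integral_add_adjacent_intervals (hui k s0 hs0t) huii]
    ring
  have hfin := hlt s0 hs0t hs0T k
  have : e * z k s0 ≤ |z k s0| := by
    calc e * z k s0 ≤ |e * z k s0| := le_abs_self _
      _ = |z k s0| := by rw [abs_mul, he1, one_mul]
  linarith

lemma bam_dual {ι : Type*} [Fintype ι] [DecidableEq ι] (C : Matrix ι ι ℝ) (ν : ι → ℝ)
    (hC : ∀ i j, 0 ≤ C i j) (hν : ∀ i, 0 < ν i)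
    (h : ∀ j, ∑ i, ν i * C i j < ν j) :
    ∃ ξ : ι → ℝ, (∀ i, 0 < ξ i) ∧ ∀ i, ∑ j, C i j * ξ j < ξ i := by
  obtain ⟨q, hq0, hq1, hq⟩ : ∃ q : ℝ, 0 ≤ q ∧ q < 1 ∧ ∀ j, ∑ i, ν i * C i j ≤ q * ν j := by
    have h1 : ∀ j, ∀ᶠ q in nhdsWithin (1:ℝ) (Set.Iio 1), ∑ i, ν i * C i j < q * ν j := by
      intro j
      have hc : ContinuousAt (fun q : ℝ => q * ν j) 1 := by fun_prop
      have := hc.eventually_const_lt (u := ∑ i, ν i * C i j) (by simpa using h j)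
      exact this.filter_mono nhdsWithin_le_nhds
    have h2 : ∀ᶠ q in nhdsWithin (1:ℝ) (Set.Iio 1), 0 ≤ q :=
      ((continuousAt_id (x := (1:ℝ))).eventually_const_lt (u := (0:ℝ)) (by simp)).filter_mono
        nhdsWithin_le_nhds |>.mono fun q hq => le_of_lt hq
    obtain ⟨q, h3, h4, h5⟩ := ((Filter.eventually_all.2 h1).and
      (h2.and self_mem_nhdsWithin)).exists
    exact ⟨q, h4, h5, fun j => (h3 j).le⟩
  let v : ℕ → ι → ℝ := fun N => Nat.rec (fun _ => 1) (fun _ x => C.mulVec x) N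
  have v0 : v 0 = fun _ => 1 := rfl
  have vs : ∀ N, v (N + 1) = C.mulVec (v N) := fun N => rfl
  have vnn : ∀ N i, 0 ≤ v N i := by
    intro N
    induction N with
    | zero => intro i; simp [v0]
    | succ N ih =>
      intro i
      rw [vs]
      exact Finset.sum_nonneg fun j _ => mul_nonneg (hC i j) (ih j)
  have vb : ∀ N, ∑ i, ν i * v N i ≤ q ^ N * ∑ i, ν i := by
    intro N
    induction N with
    | zero => simp [v0]
    | succ N ih =>
      calc ∑ i, ν i * v (N + 1) i = ∑ j, (∑ i, ν i * C i j) * v N j := by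
            simp only [vs, Matrix.mulVec, dotProduct, Finset.mul_sum, Finset.sum_mul]
            rw [Finset.sum_comm]
            exact Finset.sum_congr rfl fun i _ => Finset.sum_congr rfl fun j _ => by ring
        _ ≤ ∑ j, q * ν j * v N j :=
            Finset.sum_le_sum fun j _ => mul_le_mul_of_nonneg_right (hq j) (vnn N j)
        _ = q * ∑ j, ν j * v N j := by
            rw [Finset.mul_sum]
            exact Finset.sum_congr rfl fun i _ => by ring
        _ ≤ q * (q ^ N * ∑ i, ν i) := mul_le_mul_of_nonneg_left ih hq0
        _ = _ := by ring
  have hlim : Filter.Tendsto (fun N : ℕ => q ^ N * ∑ i, ν i) Filter.atTop (nhds 0) := by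
    simpa using (tendsto_pow_atTop_nhds_zero_of_lt_one hq0 hq1).mul_const (∑ i, ν i)
  have hev : ∀ᶠ N : ℕ in Filter.atTop, ∀ i, q ^ N * ∑ i, ν i < ν i :=
    Filter.eventually_all.2 fun i => hlim.eventually_lt_const (hν i)
  obtain ⟨N, hN, hN1⟩ := (hev.and (Filter.eventually_ge_atTop 1)).exists
  refine ⟨fun i => ∑ k ∈ Finset.range N, v k i, fun i => ?_, fun i => ?_⟩
  · refine lt_of_lt_of_le one_pos ?_
    have := Finset.single_le_sum (f := fun k => v k i) (fun k _ => vnn k i)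
      (Finset.mem_range.2 (show 0 < N from hN1))
    simpa [v0] using this
  · have e1 : ∑ j, C i j * ∑ k ∈ Finset.range N, v k j = ∑ k ∈ Finset.range N, v (k + 1) i := by
      simp only [vs, Matrix.mulVec, dotProduct, Finset.mul_sum]
      rw [Finset.sum_comm]
    rw [e1]
    have e2 := Finset.sum_range_succ (fun k => v k i) N
    rw [Finset.sum_range_succ'] at e2
    have h3 : ν i * v N i < ν i * 1 := by
      have := Finset.single_le_sum (f := fun i => ν i * v N i)
        (fun k _ => mul_nonneg (hν k).le (vnn N k)) (Finset.mem_univ i)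
      have := vb N
      have := hN i
      linarith
    have h4 : v N i < 1 := lt_of_mul_lt_mul_left h3 (hν i).le
    have h5 : v 0 i = 1 := rfl
    linarith

/-- Corollary 3.8: for the BAM system without leakage delays, under any of the four
explicit conditions below, the equilibrium `(x*, y*)` is globally exponentially stable. -/
theorem stmt16
    (n : ℕ) (hn : 0 < n)
    (r p : Fin n → ℝ → ℝ) (α R β P : Fin n → ℝ)
    (a b : Fin n → ℝ) (aij bij : Fin n → Fin n → ℝ) (I J : Fin n → ℝ)
    (f g : Fin n → ℝ → ℝ) (Lf Lg : Fin n → ℝ)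
    (l₁ l₂ : Fin n → ℝ → ℝ)
    (σ₁ σ₂ : Fin n → ℝ)
    -- (b1)
    (hr_meas : ∀ i, Measurable (r i)) (hp_meas : ∀ i, Measurable (p i))
    (hα : ∀ i, 0 < α i) (hβ : ∀ i, 0 < β i)
    (hr_bd : ∀ i t, 0 ≤ t → α i ≤ r i t ∧ r i t ≤ R i)
    (hp_bd : ∀ i t, 0 ≤ t → β i ≤ p i t ∧ p i t ≤ P i)
    -- (b2)
    (hf_cont : ∀ j, Continuous (f j)) (hg_cont : ∀ j, Continuous (g j))
    (hf_lip : ∀ j u v, |f j u - f j v| ≤ Lf j * |u - v|)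
    (hg_lip : ∀ j u v, |g j u - g j v| ≤ Lg j * |u - v|)
    -- (b3)
    (hl₁_meas : ∀ i, Measurable (l₁ i)) (hl₂_meas : ∀ i, Measurable (l₂ i))
    (hl₁ : ∀ i t, 0 ≤ t → 0 ≤ t - l₁ i t ∧ t - l₁ i t ≤ σ₁ i)
    (hl₂ : ∀ i t, 0 ≤ t → 0 ≤ t - l₂ i t ∧ t - l₂ i t ≤ σ₂ i)
    (ha : ∀ i, 0 < a i) (hb : ∀ i, 0 < b i)
    -- the equilibrium
    (xs ys : Fin n → ℝ)
    (hxs : ∀ i, a i * xs i = ∑ j, aij i j * f j (ys j) + I i)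
    (hys : ∀ i, b i * ys i = ∑ j, bij i j * g j (xs j) + J i)
    -- at least one of the four conditions
    (hcond :
      ((∀ i, ∑ j, |aij i j| * R i * Lf j / (α i * a i) < 1) ∧
       (∀ i, ∑ j, |bij i j| * P i * Lg j / (β i * b i) < 1)) ∨
      ((∀ j, ∑ i, |aij i j| * R i * Lf j / (α i * a i) < 1) ∧
       (∀ j, ∑ i, |bij i j| * P i * Lg j / (β i * b i) < 1)) ∨
      (∃ μ : Fin n ⊕ Fin n → ℝ, (∀ k, 0 < μ k) ∧
        (∀ i, ∑ j, μ (Sum.inr j) * (|aij i j| * R i * Lf j) / (α i * a i) <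
          μ (Sum.inl i)) ∧
        (∀ i, ∑ j, μ (Sum.inl j) * (|bij i j| * P i * Lg j) / (β i * b i) <
          μ (Sum.inr i))) ∨
      (∃ μ : Fin n ⊕ Fin n → ℝ, (∀ k, 0 < μ k) ∧
        (∀ j, ∑ i, μ (Sum.inr i) * (|aij i j| * R i * Lf j) / (α i * a i) <
          μ (Sum.inl j)) ∧
        (∀ j, ∑ i, μ (Sum.inl i) * (|bij i j| * P i * Lg j) / (β i * b i) <
          μ (Sum.inr j)))) :
    -- global exponential stability of the equilibrium
    ∃ M Λ : ℝ, 0 < M ∧ 0 < Λ ∧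
      ∀ t₀ : ℝ, 0 ≤ t₀ → ∀ x y : Fin n → ℝ → ℝ,
        (∀ i, Continuous (x i)) → (∀ i, Continuous (y i)) →
        (∀ i t, t₀ ≤ t → IntervalIntegrable
            (fun s => r i s * (-(a i) * x i s +
              ∑ j, aij i j * f j (y j (l₂ j s)) + I i)) volume t₀ t) →
        (∀ i t, t₀ ≤ t → IntervalIntegrable
            (fun s => p i s * (-(b i) * y i s +
              ∑ j, bij i j * g j (x j (l₁ j s)) + J i)) volume t₀ t) →
        (∀ i t, t₀ ≤ t →
          x i t = x i t₀ + ∫ s in t₀..t,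
            r i s * (-(a i) * x i s +
              ∑ j, aij i j * f j (y j (l₂ j s)) + I i)) →
        (∀ i t, t₀ ≤ t →
          y i t = y i t₀ + ∫ s in t₀..t,
            p i s * (-(b i) * y i s +
              ∑ j, bij i j * g j (x j (l₁ j s)) + J i)) →
        ∀ t, t₀ ≤ t →
          ‖((fun i => x i t - xs i, fun i => y i t - ys i) : (Fin n → ℝ) × (Fin n → ℝ))‖ ≤
            M * Real.exp (-Λ * (t - t₀)) *
              (‖((fun i => x i t₀ - xs i, fun i => y i t₀ - ys i) :
                  (Fin n → ℝ) × (Fin n → ℝ))‖ +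
                sSup ((fun s =>
                    ‖((fun i => x i s - xs i, fun i => y i s - ys i) :
                      (Fin n → ℝ) × (Fin n → ℝ))‖) ''
                  Set.Icc (t₀ - max (⨆ i, σ₁ i) (⨆ i, σ₂ i)) t₀)) := by
  classical
  have hLf : ∀ j, 0 ≤ Lf j := fun j => by
    have := (abs_nonneg _).trans (hf_lip j 1 0); simpa using this
  have hLg : ∀ j, 0 ≤ Lg j := fun j => by
    have := (abs_nonneg _).trans (hg_lip j 1 0); simpa using this
  have hαR : ∀ i, α i ≤ R i := fun i => (hr_bd i 0 le_rfl).1.trans (hr_bd i 0 le_rfl).2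
  have hβP : ∀ i, β i ≤ P i := fun i => (hp_bd i 0 le_rfl).1.trans (hp_bd i 0 le_rfl).2
  have hR : ∀ i, 0 < R i := fun i => (hα i).trans_le (hαR i)
  have hP : ∀ i, 0 < P i := fun i => (hβ i).trans_le (hβP i)
  -- condition (4) implies condition (3)
  have h43 : (∃ μ : Fin n ⊕ Fin n → ℝ, (∀ k, 0 < μ k) ∧
        (∀ j, ∑ i, μ (Sum.inr i) * (|aij i j| * R i * Lf j) / (α i * a i) <
          μ (Sum.inl j)) ∧
        (∀ j, ∑ i, μ (Sum.inl i) * (|bij i j| * P i * Lg j) / (β i * b i) <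
          μ (Sum.inr j))) →
      (∃ μ : Fin n ⊕ Fin n → ℝ, (∀ k, 0 < μ k) ∧
        (∀ i, ∑ j, μ (Sum.inr j) * (|aij i j| * R i * Lf j) / (α i * a i) <
          μ (Sum.inl i)) ∧
        (∀ i, ∑ j, μ (Sum.inl j) * (|bij i j| * P i * Lg j) / (β i * b i) <
          μ (Sum.inr i))) := by
    rintro ⟨μ, hμ, h1, h2⟩
    obtain ⟨ξ, hξ, hξ2⟩ := bam_dual
      (Matrix.fromBlocks 0 (Matrix.of fun i j => |aij i j| * R i * Lf j / (α i * a i))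
        (Matrix.of fun i j => |bij i j| * P i * Lg j / (β i * b i)) 0)
      (fun k => μ k.swap)
      (by
        rintro (i | i) (j | j)
        · simp
        · simpa using div_nonneg (mul_nonneg (mul_nonneg (abs_nonneg _) (hR i).le) (hLf j))
            (mul_pos (hα i) (ha i)).le
        · simpa using div_nonneg (mul_nonneg (mul_nonneg (abs_nonneg _) (hP i).le) (hLg j))
            (mul_pos (hβ i) (hb i)).le
        · simp)
      (fun k => hμ _)
      (by
        rintro (j | j)
        · simpa [Fintype.sum_sum_type, mul_div_assoc] using h2 j
        · simpa [Fintype.sum_sum_type, mul_div_assoc] using h1 j)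
    refine ⟨ξ, hξ, fun i => ?_, fun i => ?_⟩
    · have := hξ2 (Sum.inl i)
      simp only [Fintype.sum_sum_type, Matrix.fromBlocks_apply₁₁, Matrix.fromBlocks_apply₁₂,
        Matrix.zero_apply, zero_mul, Finset.sum_const_zero, zero_add, Matrix.of_apply] at this
      refine lt_of_eq_of_lt (Finset.sum_congr rfl fun j _ => ?_) this
      ring
    · have := hξ2 (Sum.inr i)
      simp only [Fintype.sum_sum_type, Matrix.fromBlocks_apply₂₁, Matrix.fromBlocks_apply₂₂,
        Matrix.zero_apply, zero_mul, Finset.sum_const_zero, add_zero, Matrix.of_apply] at this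
      refine lt_of_eq_of_lt (Finset.sum_congr rfl fun j _ => ?_) this
      ring
  obtain ⟨ξ, hξ, hξ1, hξ2⟩ : ∃ μ : Fin n ⊕ Fin n → ℝ, (∀ k, 0 < μ k) ∧
        (∀ i, ∑ j, μ (Sum.inr j) * (|aij i j| * R i * Lf j) / (α i * a i) <
          μ (Sum.inl i)) ∧
        (∀ i, ∑ j, μ (Sum.inl j) * (|bij i j| * P i * Lg j) / (β i * b i) <
          μ (Sum.inr i)) := by
    rcases hcond with ⟨h1, h2⟩ | ⟨h1, h2⟩ | h | h
    · exact ⟨fun _ => 1, fun _ => one_pos, by simpa using h1, by simpa using h2⟩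
    · exact h43 ⟨fun _ => 1, fun _ => one_pos, by simpa using h1, by simpa using h2⟩
    · exact h
    · exact h43 h
  clear hcond h43
  have gain : ∀ (al A RR : ℝ) (w L ζ : Fin n → ℝ) (X : ℝ), 0 < al → al ≤ RR → 0 < A →
      (∀ j, 0 ≤ L j) → (∀ j, 0 < ζ j) →
      ∑ j, ζ j * (|w j| * RR * L j) / (al * A) < X → ∑ j, |w j| * L j * ζ j < A * X := by
    intro al A RR w L ζ X hal hRR hA hL hζ h
    have e : ∑ j, ζ j * (|w j| * RR * L j) / (al * A)
        = RR / al * (∑ j, |w j| * L j * ζ j) / A := by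
      rw [Finset.mul_sum, Finset.sum_div]
      exact Finset.sum_congr rfl fun j _ => by field_simp
    rw [e, div_lt_iff₀ hA] at h
    have hs : 0 ≤ ∑ j, |w j| * L j * ζ j :=
      Finset.sum_nonneg fun j _ => mul_nonneg (mul_nonneg (abs_nonneg _) (hL j)) (hζ j).le
    have h1 : 1 ≤ RR / al := (one_le_div hal).2 hRR
    nlinarith
  set c : Fin n ⊕ Fin n → Fin n ⊕ Fin n → ℝ :=
    Matrix.fromBlocks 0 (Matrix.of fun i j => |aij i j| * Lf j)
      (Matrix.of fun i j => |bij i j| * Lg j) 0 with hcdef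
  have c11 : ∀ i j, c (Sum.inl i) (Sum.inl j) = 0 := fun _ _ => rfl
  have c12 : ∀ i j, c (Sum.inl i) (Sum.inr j) = |aij i j| * Lf j := fun _ _ => rfl
  have c21 : ∀ i j, c (Sum.inr i) (Sum.inl j) = |bij i j| * Lg j := fun _ _ => rfl
  have c22 : ∀ i j, c (Sum.inr i) (Sum.inr j) = 0 := fun _ _ => rfl
  have hc : ∀ k m, 0 ≤ c k m := by
    rintro (i | i) (j | j)
    · rw [c11]
    · rw [c12]; exact mul_nonneg (abs_nonneg _) (hLf j)
    · rw [c21]; exact mul_nonneg (abs_nonneg _) (hLg j)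
    · rw [c22]
  set A : Fin n ⊕ Fin n → ℝ := Sum.elim a b with hA
  set al : Fin n ⊕ Fin n → ℝ := Sum.elim α β with hal
  have halpos : ∀ k, 0 < al k := by
    rintro (i | i)
    · exact hα i
    · exact hβ i
  have hstrict : ∀ k, ∑ m, c k m * ξ m < A k * ξ k := by
    rintro (i | i)
    · simp only [Fintype.sum_sum_type, c11, c12, zero_mul, Finset.sum_const_zero, zero_add]
      exact gain (α i) (a i) (R i) (aij i) Lf _ _ (hα i) (hαR i) (ha i) hLf
        (fun j => hξ (Sum.inr j)) (hξ1 i)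
    · simp only [Fintype.sum_sum_type, c21, c22, zero_mul, Finset.sum_const_zero, add_zero]
      exact gain (β i) (b i) (P i) (bij i) Lg _ _ (hβ i) (hβP i) (hb i) hLg
        (fun j => hξ (Sum.inl j)) (hξ2 i)
  set S := max (⨆ i, σ₁ i) (⨆ i, σ₂ i) with hSdef
  have hS1 : ∀ i, σ₁ i ≤ S := fun i =>
    (le_ciSup (Set.finite_range σ₁).bddAbove i).trans (le_max_left _ _)
  have hS2 : ∀ i, σ₂ i ≤ S := fun i =>
    (le_ciSup (Set.finite_range σ₂).bddAbove i).trans (le_max_right _ _)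
  have hS : 0 ≤ S := by
    have h1 := hl₁ ⟨0, hn⟩ 0 le_rfl
    exact (h1.1.trans h1.2).trans (hS1 _)
  obtain ⟨lam, hrate, hlam⟩ : ∃ lam : ℝ, (∀ k, lam * ξ k / al k +
      Real.exp (lam * S) * ∑ m, c k m * ξ m < A k * ξ k) ∧ 0 < lam := by
    have h1 : ∀ k, ∀ᶠ lam in nhdsWithin (0:ℝ) (Set.Ioi 0), lam * ξ k / al k +
      Real.exp (lam * S) * ∑ m, c k m * ξ m < A k * ξ k := by
      intro k
      have hcont : ContinuousAt (fun lam : ℝ => lam * ξ k / al k +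
        Real.exp (lam * S) * ∑ m, c k m * ξ m) 0 := by fun_prop
      have := hcont.eventually_lt_const (u := A k * ξ k) (by simpa using hstrict k)
      exact this.filter_mono nhdsWithin_le_nhds
    exact ((Filter.eventually_all.2 h1).and self_mem_nhdsWithin).exists
  obtain ⟨X, hX⟩ := (Set.finite_range ξ).bddAbove
  obtain ⟨V, hV⟩ := (Set.finite_range fun k => (ξ k)⁻¹).bddAbove
  have hX' : ∀ k, ξ k ≤ X := fun k => hX ⟨k, rfl⟩
  have hV' : ∀ k, (ξ k)⁻¹ ≤ V := fun k => hV ⟨k, rfl⟩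
  have hXpos : 0 < X := (hξ (Sum.inl ⟨0, hn⟩)).trans_le (hX' _)
  have hVpos : 0 < V := (inv_pos.2 (hξ (Sum.inl ⟨0, hn⟩))).trans_le (hV' _)
  refine ⟨V * X, lam, mul_pos hVpos hXpos, hlam, ?_⟩
  intro t₀ ht₀ x y hxc hyc hxi hyi hx hy t ht
  set Z : ℝ → (Fin n → ℝ) × (Fin n → ℝ) := fun s =>
    (fun i => x i s - xs i, fun i => y i s - ys i) with hZ
  have hZc : Continuous Z := by
    simp only [hZ]; fun_prop
  set z : Fin n ⊕ Fin n → ℝ → ℝ := Sum.elim (fun i s => x i s - xs i)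
    (fun i s => y i s - ys i) with hz
  have hzZ : ∀ k s, |z k s| ≤ ‖Z s‖ := by
    rintro (i | i) s
    · exact (norm_le_pi_norm (Z s).1 i).trans (norm_fst_le _)
    · exact (norm_le_pi_norm (Z s).2 i).trans (norm_snd_le _)
  have hbdd : BddAbove ((fun s => ‖Z s‖) '' Set.Icc (t₀ - S) t₀) :=
    (isCompact_Icc.image hZc.norm).bddAbove
  set D := ‖Z t₀‖ + sSup ((fun s => ‖Z s‖) '' Set.Icc (t₀ - S) t₀) with hD
  have hZD : ∀ s, t₀ - S ≤ s → s ≤ t₀ → ‖Z s‖ ≤ D := by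
    intro s h1 h2
    have h3 := le_csSup hbdd ⟨s, ⟨h1, h2⟩, rfl⟩
    have h4 := norm_nonneg (Z t₀)
    simp only at h3
    linarith
  have hD0 : 0 ≤ D := (norm_nonneg _).trans (hZD t₀ (by linarith) le_rfl)
  set u : Fin n ⊕ Fin n → ℝ → ℝ := Sum.elim
    (fun i s => r i s * (-(a i) * x i s + ∑ j, aij i j * f j (y j (l₂ j s)) + I i))
    (fun i s => p i s * (-(b i) * y i s + ∑ j, bij i j * g j (x j (l₁ j s)) + J i)) with hu
  have hmain : ∀ ε : ℝ, 0 < ε → ∀ k,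
      |z k t| ≤ (V * D + ε) * ξ k * Real.exp (-lam * (t - t₀)) := by
    intro ε hε k
    refine bam_core al A ξ c S lam halpos hc hξ hlam hrate t₀ z u (Sum.elim l₁ l₂)
      ?_ ?_ ?_ ?_ ?_ hS (V * D + ε) (by positivity) ?_ t ht k
    · rintro (i | i)
      · exact (hxc i).sub continuous_const
      · exact (hyc i).sub continuous_const
    · rintro (i | i) s hs
      · exact hxi i s hs
      · exact hyi i s hs
    · rintro (i | i) s hs
      · simp only [hz, hu, Sum.elim_inl]
        rw [hx i s hs]; ring
      · simp only [hz, hu, Sum.elim_inr]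
        rw [hy i s hs]; ring
    · rintro (i | i) s hs
      · refine ⟨r i s, ∑ j, aij i j * (f j (y j (l₂ j s)) - f j (ys j)),
          (hr_bd i s (ht₀.trans hs)).1, ?_, ?_⟩
        · simp only [hz, hu, hA, Sum.elim_inl, mul_sub, Finset.sum_sub_distrib]
          have := hxs i
          congr 1
          linarith
        · simp only [Fintype.sum_sum_type, c11, c12, zero_mul, Finset.sum_const_zero, zero_add]
          refine (Finset.abs_sum_le_sum_abs _ _).trans (Finset.sum_le_sum fun j _ => ?_)
          rw [abs_mul, mul_assoc]
          exact mul_le_mul_of_nonneg_left (hf_lip j _ _) (abs_nonneg _)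
      · refine ⟨p i s, ∑ j, bij i j * (g j (x j (l₁ j s)) - g j (xs j)),
          (hp_bd i s (ht₀.trans hs)).1, ?_, ?_⟩
        · simp only [hz, hu, hA, Sum.elim_inr, mul_sub, Finset.sum_sub_distrib]
          have := hys i
          congr 1
          linarith
        · simp only [Fintype.sum_sum_type, c21, c22, zero_mul, Finset.sum_const_zero, add_zero]
          refine (Finset.abs_sum_le_sum_abs _ _).trans (Finset.sum_le_sum fun j _ => ?_)
          rw [abs_mul, mul_assoc]
          exact mul_le_mul_of_nonneg_left (hg_lip j _ _) (abs_nonneg _)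
    · rintro (i | i) s hs
      · exact ⟨(hl₁ i s (ht₀.trans hs)).1, (hl₁ i s (ht₀.trans hs)).2.trans (hS1 i)⟩
      · exact ⟨(hl₂ i s (ht₀.trans hs)).1, (hl₂ i s (ht₀.trans hs)).2.trans (hS2 i)⟩
    · intro m s h1 h2
      have h3 := (hzZ m s).trans (hZD s h1 h2)
      have h4 : 1 ≤ V * ξ m := by
        have := mul_le_mul_of_nonneg_right (hV' m) (hξ m).le
        rwa [inv_mul_cancel₀ (hξ m).ne'] at this
      have h5 := mul_pos hε (hξ m)
      nlinarith
  have hfin : ∀ k, |z k t| ≤ V * X * Real.exp (-lam * (t - t₀)) * D := by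
    intro k
    have hE := Real.exp_pos (-lam * (t - t₀))
    have h1 : |z k t| ≤ V * D * ξ k * Real.exp (-lam * (t - t₀)) := by
      refine le_of_forall_pos_le_add fun η hη => ?_
      have hpos : 0 < ξ k * Real.exp (-lam * (t - t₀)) := mul_pos (hξ k) hE
      refine (hmain (η / (ξ k * Real.exp (-lam * (t - t₀)))) (div_pos hη hpos) k).trans
        (le_of_eq ?_)
      have := (hξ k).ne'
      field_simp
    calc |z k t| ≤ V * D * ξ k * Real.exp (-lam * (t - t₀)) := h1
      _ ≤ V * D * X * Real.exp (-lam * (t - t₀)) := by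
        gcongr
        exact hX' k
      _ = _ := by ring
  have hnn : 0 ≤ V * X * Real.exp (-lam * (t - t₀)) * D := by positivity
  have : ‖Z t‖ ≤ V * X * Real.exp (-lam * (t - t₀)) * D := by
    refine norm_prod_le_iff.2 ⟨?_, ?_⟩
    · exact (pi_norm_le_iff_of_nonneg hnn).2 fun i => hfin (Sum.inl i)
    · exact (pi_norm_le_iff_of_nonneg hnn).2 fun i => hfin (Sum.inr i)
  exact this
end
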